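/- Let μ be an ergodic Φ-invariant probability measure and let Φ_r be a time reparameterization via r ∈ L¹(M,μ) with ∫ r dμ > 0. Then the metric entropies satisfy h_{μ_r}(Φ_r) · ∫ r dμ = h_μ(Φ), where dμ_r = (r/∫r dμ) dμ. (Abramov's formula for flows under time change.) -/

import Mathlib

open MeasureTheory Filter intervalIntegral

/-- Entropy of a countable measurable partition given as a coloring. -/
noncomputable def colorEntropy {M : Type*} [MeasurableSpace M] (μ : Measure M)
    {ι : Type*} [Countable ι] (c : M → ι) : ℝ :=
  ∑' i : ι, Real.negMulLog (μ (c ⁻¹' {i})).toReal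

/-- Kolmogorov–Sinai (metric) entropy of a map `T` with respect to `μ`. -/
noncomputable def metricEntropy {M : Type*} [MeasurableSpace M] (T : M → M)
    (μ : Measure M) : ℝ :=
  ⨆ c : {c : M → ℕ // Measurable c ∧ (Set.range c).Finite},
    Filter.liminf
      (fun n : ℕ => colorEntropy μ (fun x (i : Fin n) => c.1 (T^[(i : ℕ)] x)) / n)
      Filter.atTop


section Coding

set_option linter.unusedSectionVars false

variable {α T : Type*} [Fintype α] [DecidableEq α] [Fintype T]

/-- Emission weights: predicted letter with weight `1-ε`, others `ε/N`. -/
noncomputable def emis (ε : ℝ) (x y : α) : ℝ := if x = y then 1 - ε else ε / Fintype.card α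

lemma emis_nonneg {ε : ℝ} (h0 : 0 < ε) (h1 : ε < 1) (x y : α) : 0 ≤ emis ε x y := by
  unfold emis
  split_ifs
  · linarith
  · positivity

lemma emis_sum {ε : ℝ} (h0 : 0 < ε) (y : α) : ∑ x, emis ε x y ≤ 1 := by
  have hc : (0:ℝ) < Fintype.card α := by
    have : 0 < Fintype.card α := Fintype.card_pos_iff.mpr ⟨y⟩
    exact_mod_cast this
  calc ∑ x, emis ε x y ≤ ∑ x, ((if x = y then 1 - ε else 0) + ε / Fintype.card α) := by
        apply Finset.sum_le_sum
        intro x _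
        unfold emis
        have : 0 ≤ ε / Fintype.card α := by positivity
        split_ifs <;> linarith
    _ = 1 := by
        rw [Finset.sum_add_distrib]
        simp
        field_simp
        ring

lemma emis_prod_sum {ε : ℝ} (h0 : 0 < ε) (h1 : ε < 1) {m : ℕ} (v : Fin m → α) :
    ∑ w : Fin m → α, ∏ j, emis ε (w j) (v j) ≤ 1 := by
  have h := Finset.prod_univ_sum (fun _ : Fin m => (Finset.univ : Finset α))
    (fun j x => emis ε x (v j))
  rw [Fintype.piFinset_univ] at h
  rw [← h]
  apply Finset.prod_le_one
  · intro i _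
    exact Finset.sum_nonneg fun x _ => emis_nonneg h0 h1 _ _
  · intro i _
    exact emis_sum h0 _

lemma emis_prod_ge {ε : ℝ} (h0 : 0 < ε) (h1 : ε < 1) {m : ℕ} (w v : Fin m → α) :
    (1 - ε) ^ m * (ε / Fintype.card α) ^ (Finset.univ.filter fun j => w j ≠ v j).card
      ≤ ∏ j, emis ε (w j) (v j) := by
  have e1 : (1 - ε) ^ m * (ε / Fintype.card α) ^ (Finset.univ.filter fun j => w j ≠ v j).card
      = ∏ j : Fin m, ((1 - ε) * (if w j ≠ v j then ε / Fintype.card α else 1)) := by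
    rw [Finset.prod_mul_distrib]
    simp [Finset.prod_ite]
    left
    rw [div_pow]
  rw [e1]
  apply Finset.prod_le_prod
  · intro i _
    have : 0 ≤ ε / Fintype.card α := by positivity
    split_ifs <;> nlinarith
  · intro i _
    have : 0 ≤ ε / Fintype.card α := by positivity
    unfold emis
    by_cases h : w i = v i
    · simp [h]
    · simp [h]
      nlinarith

/-- position of `j` inside its level set of `β` -/
def vpos (β : ℕ → ℕ) (j : ℕ) : ℕ := ((Finset.range j).filter fun j' => β j' = β j).card

/-- predicted letters -/
def what (d0 : α) (pred : T → ℕ → ℕ → α) (k : ℕ) (s : ℕ → T) (β : ℕ → ℕ) (j : ℕ) : α :=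
  if β j = 0 then d0 else pred (s ((β j - 1) / k)) ((β j - 1) % k) (vpos β j)

lemma what_congr (d0 : α) (pred : T → ℕ → ℕ → α) (k : ℕ) (hk : 0 < k) (K m : ℕ) (s s' : ℕ → T)
    (β β' : ℕ → ℕ) (hs : ∀ i < K, s i = s' i) (hβ : ∀ j < m, β j = β' j)
    (hK : ∀ j < m, β j ≤ k * K) (j : ℕ) (hj : j < m) :
    what d0 pred k s β j = what d0 pred k s' β' j := by
  have hv : vpos β j = vpos β' j := by
    unfold vpos
    congr 1
    apply Finset.filter_congr
    intro x hx
    rw [Finset.mem_range] at hx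
    rw [hβ x (by omega), hβ j hj]
  unfold what
  rw [hv, ← hβ j hj]
  split_ifs with h
  · rfl
  · rw [hs]
    have := hK j hj
    rw [Nat.div_lt_iff_lt_mul hk]
    rw [mul_comm] at this
    omega

noncomputable def extS {K : ℕ} (t0 : T) (s : Fin K → T) (i : ℕ) : T :=
  if h : i < K then s ⟨i, h⟩ else t0

noncomputable def extD {m B : ℕ} (d : Fin m → Fin B) (j : ℕ) : ℕ :=
  ∑ i ∈ Finset.range (j + 1), if h : i < m then (d ⟨i, h⟩ : ℕ) else 0

noncomputable def innerW (ε δ : ℝ) (d0 : α) (t0 : T) (π : T → ℝ) (pred : T → ℕ → ℕ → α) (k m K : ℕ)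
    (w : Fin m → α) : ℝ :=
  ∑ s : Fin K → T, ∑ d : Fin m → Fin (k * K + 1),
    (∏ i, π (s i)) * (∏ j, ((1 - δ) * δ ^ (d j : ℕ))) *
      ∏ j : Fin m, emis ε (w j) (what d0 pred k (extS t0 s) (extD d) j)

lemma innerW_nonneg {ε δ : ℝ} (h0 : 0 < ε) (h1 : ε < 1) (hd0 : 0 < δ) (hd1 : δ < 1)
    (d0 : α) (t0 : T) (π : T → ℝ) (hπ : ∀ t, 0 ≤ π t)
    (pred : T → ℕ → ℕ → α) (k m K : ℕ) (w : Fin m → α) :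
    0 ≤ innerW ε δ d0 t0 π pred k m K w := by
  unfold innerW
  refine Finset.sum_nonneg fun s _ => Finset.sum_nonneg fun d _ => ?_
  refine mul_nonneg (mul_nonneg (Finset.prod_nonneg fun i _ => hπ _)
    (Finset.prod_nonneg fun j _ => ?_)) (Finset.prod_nonneg fun j _ => emis_nonneg h0 h1 _ _)
  have : 0 ≤ 1 - δ := by linarith
  positivity

lemma geom_fin_le {δ : ℝ} (hd0 : 0 < δ) (B : ℕ) :
    ∑ d : Fin B, (1 - δ) * δ ^ (d : ℕ) ≤ 1 := by
  rw [← Finset.mul_sum, Fin.sum_univ_eq_sum_range (fun i => δ ^ i) B]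
  have := mul_neg_geom_sum δ B
  rw [this]
  have : 0 ≤ δ ^ B := by positivity
  linarith

lemma innerW_sum {ε δ : ℝ} (h0 : 0 < ε) (h1 : ε < 1) (hd0 : 0 < δ) (hd1 : δ < 1)
    (d0 : α) (t0 : T) (π : T → ℝ) (hπ : ∀ t, 0 ≤ π t) (hπs : ∑ t, π t ≤ 1)
    (pred : T → ℕ → ℕ → α) (k m K : ℕ) :
    ∑ w, innerW ε δ d0 t0 π pred k m K w ≤ 1 := by
  unfold innerW
  have h1d : 0 ≤ 1 - δ := by linarith
  rw [Finset.sum_comm]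
  calc _ ≤ ∑ s : Fin K → T, ∑ d : Fin m → Fin (k * K + 1),
          (∏ i, π (s i)) * (∏ j, ((1 - δ) * δ ^ (d j : ℕ))) := by
        apply Finset.sum_le_sum
        intro s _
        rw [Finset.sum_comm]
        apply Finset.sum_le_sum
        intro d _
        rw [← Finset.mul_sum]
        apply mul_le_of_le_one_right
        · refine mul_nonneg (Finset.prod_nonneg fun i _ => hπ _)
            (Finset.prod_nonneg fun j _ => by positivity)
        · exact emis_prod_sum h0 h1 _
    _ = (∑ s : Fin K → T, ∏ i, π (s i)) *
          ∑ d : Fin m → Fin (k * K + 1), ∏ j, ((1 - δ) * δ ^ (d j : ℕ)) := by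
        rw [Finset.sum_mul_sum]
    _ ≤ 1 := by
        have e1 := Finset.prod_univ_sum (fun _ : Fin K => (Finset.univ : Finset T))
          (fun _ t => π t)
        have e2 := Finset.prod_univ_sum (fun _ : Fin m => (Finset.univ : Finset (Fin (k * K + 1))))
          (fun _ d => (1 - δ) * δ ^ (d : ℕ))
        rw [Fintype.piFinset_univ] at e1 e2
        rw [← e1, ← e2]
        apply mul_le_one₀
        · exact Finset.prod_le_one (fun _ _ => Finset.sum_nonneg fun t _ => hπ t) (fun _ _ => hπs)
        · exact Finset.prod_nonneg fun _ _ => Finset.sum_nonneg fun t _ => by positivity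
        · exact Finset.prod_le_one (fun _ _ => Finset.sum_nonneg fun t _ => by positivity)
            (fun _ _ => geom_fin_le hd0 _)

lemma innerW_ge {ε δ : ℝ} (h0 : 0 < ε) (h1 : ε < 1) (hd0 : 0 < δ) (hd1 : δ < 1)
    (d0 : α) (t0 : T) (π : T → ℝ) (hπ : ∀ t, 0 ≤ π t)
    (pred : T → ℕ → ℕ → α) (k m K : ℕ) (hk : 0 < k) (s : ℕ → T) (β : ℕ → ℕ) (hβ : Monotone β)
    (hK : ∀ j < m, β j ≤ k * K) (w : Fin m → α) :
    (∏ i ∈ Finset.range K, π (s i)) * ((1 - δ) ^ m * δ ^ (k * K)) *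
      ((1 - ε) ^ m * (ε / Fintype.card α) ^
        (Finset.univ.filter fun j : Fin m => w j ≠ what d0 pred k s β j).card)
      ≤ innerW ε δ d0 t0 π pred k m K w := by
  have h1d : 0 ≤ 1 - δ := by linarith
  set s₀ : Fin K → T := fun i => s i with hs₀
  set d₀ : Fin m → Fin (k * K + 1) := fun j =>
    ⟨if (j : ℕ) = 0 then β 0 else β j - β (j - 1), by
      have := hK j j.2
      split_ifs with h
      · rw [h] at this; omega
      · omega⟩ with hd₀
  have hext : ∀ j < m, extD d₀ j = β j := by
    intro j hj
    induction j with
    | zero => simp [extD, hd₀, hj]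
    | succ j ih =>
      have ih' := ih (by omega)
      unfold extD at ih' ⊢
      rw [Finset.sum_range_succ, ih']
      have : β j ≤ β (j + 1) := hβ (by omega)
      simp [hd₀, hj]
      omega
  have hwhat : ∀ j : Fin m, what d0 pred k (extS t0 s₀) (extD d₀) j = what d0 pred k s β j := by
    intro j
    apply what_congr d0 pred k hk K m
    · intro i hi
      simp [extS, hi, hs₀]
    · exact hext
    · intro j hj
      rw [hext j hj]
      exact hK j hj
    · exact j.2
  have hnn : ∀ (s : Fin K → T) (d : Fin m → Fin (k * K + 1)), 0 ≤ (∏ i, π (s i)) * (∏ j, ((1 - δ) * δ ^ (d j : ℕ))) *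
      ∏ j : Fin m, emis ε (w j) (what d0 pred k (extS t0 s) (extD d) j) := by
    intro s d
    refine mul_nonneg (mul_nonneg (Finset.prod_nonneg fun i _ => hπ _)
      (Finset.prod_nonneg fun j _ => ?_)) (Finset.prod_nonneg fun j _ => emis_nonneg h0 h1 _ _)
    positivity
  have hsum : ∑ j : Fin m, (d₀ j : ℕ) ≤ k * K := by
    rcases Nat.eq_zero_or_pos m with hm | hm
    · subst hm; simp
    · have := hext (m - 1) (by omega)
      unfold extD at this
      rw [show m - 1 + 1 = m by omega, Finset.sum_range] at this
      simp only [Fin.is_lt, dite_true] at this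
      have e : ∑ j : Fin m, (d₀ j : ℕ) = β (m - 1) := by
        rw [← this]
      rw [e]
      exact hK _ (by omega)
  unfold innerW
  calc _ ≤ (∏ i, π (s₀ i)) * (∏ j, ((1 - δ) * δ ^ (d₀ j : ℕ))) *
      ∏ j : Fin m, emis ε (w j) (what d0 pred k (extS t0 s₀) (extD d₀) j) := by
        have hA : 0 ≤ ∏ i ∈ Finset.range K, π (s i) := Finset.prod_nonneg fun i _ => hπ _
        have e1 : ∏ i, π (s₀ i) = ∏ i ∈ Finset.range K, π (s i) := by
          rw [Finset.prod_range]
        have e2 : (1 - δ) ^ m * δ ^ (k * K) ≤ ∏ j, ((1 - δ) * δ ^ (d₀ j : ℕ)) := by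
          rw [Finset.prod_mul_distrib, Finset.prod_pow_eq_pow_sum]
          simp only [Finset.prod_const, Finset.card_univ, Fintype.card_fin]
          apply mul_le_mul_of_nonneg_left _ (by positivity)
          exact pow_le_pow_of_le_one hd0.le hd1.le hsum
        simp only [hwhat]
        rw [e1]
        apply mul_le_mul
        · exact mul_le_mul_of_nonneg_left e2 hA
        · exact emis_prod_ge h0 h1 w (fun j => what d0 pred k s β j)
        · have : 0 ≤ 1 - ε := by linarith
          positivity
        · exact mul_nonneg hA (Finset.prod_nonneg fun j _ => by positivity)
    _ ≤ ∑ d : Fin m → Fin (k * K + 1), (∏ i, π (s₀ i)) * (∏ j, ((1 - δ) * δ ^ (d j : ℕ))) *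
      ∏ j : Fin m, emis ε (w j) (what d0 pred k (extS t0 s₀) (extD d) j) :=
        Finset.single_le_sum (f := fun d : Fin m → Fin (k * K + 1) =>
          (∏ i, π (s₀ i)) * (∏ j, ((1 - δ) * δ ^ (d j : ℕ))) *
          ∏ j : Fin m, emis ε (w j) (what d0 pred k (extS t0 s₀) (extD d) j))
          (fun d _ => hnn s₀ d) (Finset.mem_univ d₀)
    _ ≤ _ := Finset.single_le_sum (f := fun s : Fin K → T => ∑ d : Fin m → Fin (k * K + 1),
          (∏ i, π (s i)) * (∏ j, ((1 - δ) * δ ^ (d j : ℕ))) *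
          ∏ j : Fin m, emis ε (w j) (what d0 pred k (extS t0 s) (extD d) j))
          (fun s _ => Finset.sum_nonneg fun d _ => hnn s d) (Finset.mem_univ s₀)

/-- The coding lemma. -/
lemma coding {ε δ : ℝ} (h0 : 0 < ε) (h1 : ε < 1) (hd0 : 0 < δ) (hd1 : δ < 1)
    (d0 : α) (t0 : T) (π : T → ℝ) (hπ : ∀ t, 0 ≤ π t) (hπs : ∑ t, π t ≤ 1)
    (pred : T → ℕ → ℕ → α) (k m : ℕ) (hk : 0 < k) :
    ∃ P : (Fin m → α) → ℝ, (∀ w, 0 ≤ P w) ∧ ∑ w, P w ≤ 1 ∧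
      ∀ (K : ℕ) (s : ℕ → T) (β : ℕ → ℕ), Monotone β → (∀ j < m, β j ≤ k * K) →
      ∀ w : Fin m → α,
      (1 / 2 : ℝ) ^ (K + 1) * ((∏ i ∈ Finset.range K, π (s i)) * ((1 - δ) ^ m * δ ^ (k * K)) *
      ((1 - ε) ^ m * (ε / Fintype.card α) ^
        (Finset.univ.filter fun j : Fin m => w j ≠ what d0 pred k s β j).card)) ≤ P w := by
  have hg : HasSum (fun K : ℕ => (1 / 2 : ℝ) ^ (K + 1)) 1 := by
    have := hasSum_geometric_two.mul_left (1 / 2 : ℝ)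
    simp only [← pow_succ'] at this
    simpa using this
  have hnn := innerW_nonneg h0 h1 hd0 hd1 d0 t0 π hπ pred k m
  have hle := innerW_sum h0 h1 hd0 hd1 d0 t0 π hπ hπs pred k m
  have hle1 : ∀ K w, innerW ε δ d0 t0 π pred k m K w ≤ 1 := fun K w =>
    (Finset.single_le_sum (fun w _ => hnn K w) (Finset.mem_univ w)).trans (hle K)
  have hsm : ∀ w, Summable fun K : ℕ => (1 / 2 : ℝ) ^ (K + 1) * innerW ε δ d0 t0 π pred k m K w := by
    intro w
    apply Summable.of_nonneg_of_le _ _ hg.summable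
    · intro K
      exact mul_nonneg (by positivity) (hnn K w)
    · intro K
      exact mul_le_of_le_one_right (by positivity) (hle1 K w)
  refine ⟨fun w => ∑' K : ℕ, (1 / 2 : ℝ) ^ (K + 1) * innerW ε δ d0 t0 π pred k m K w, ?_, ?_, ?_⟩
  · intro w
    exact tsum_nonneg fun K => mul_nonneg (by positivity) (hnn K w)
  · rw [← Summable.tsum_finsetSum (fun w _ => hsm w)]
    refine le_trans ?_ hg.tsum_eq.le
    apply Summable.tsum_le_tsum _ (summable_sum fun w _ => hsm w) hg.summable
    intro K
    rw [← Finset.mul_sum]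
    exact mul_le_of_le_one_right (by positivity) (hle K)
  · intro K s β hβ hK w
    refine le_trans ?_ ((hsm w).le_tsum K fun K' _ => mul_nonneg (by positivity) (hnn K' w))
    apply mul_le_mul_of_nonneg_left _ (by positivity)
    exact innerW_ge h0 h1 hd0 hd1 d0 t0 π hπ pred k m K hk s β hβ hK w

end Coding


section NL
open scoped ENNReal

/-- code length of a weight -/
noncomputable def nl (x : ℝ) : ℝ≥0∞ := if x ≤ 0 then ⊤ else ENNReal.ofReal (-Real.log x)

lemma nl_anti {x y : ℝ} (h : x ≤ y) : nl y ≤ nl x := by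
  unfold nl
  by_cases hx : x ≤ 0
  · simp [hx]
  · have hy : ¬ y ≤ 0 := by linarith
    simp only [hx, hy, if_false]
    apply ENNReal.ofReal_le_ofReal
    have := Real.log_le_log (not_le.mp hx) h
    linarith

lemma nl_mul {x y : ℝ} (hx : 0 ≤ x) (hy : 0 ≤ y) : nl (x * y) ≤ nl x + nl y := by
  unfold nl
  rcases hx.eq_or_lt with rfl | hx
  · simp
  rcases hy.eq_or_lt with rfl | hy
  · simp
  have h : 0 < x * y := mul_pos hx hy
  simp only [not_le.mpr hx, not_le.mpr hy, not_le.mpr h, if_false]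
  rw [Real.log_mul hx.ne' hy.ne', neg_add]
  exact ENNReal.ofReal_add_le

lemma nl_one : nl 1 = 0 := by simp [nl]

lemma nl_pow {x : ℝ} (hx : 0 ≤ x) (n : ℕ) : nl (x ^ n) ≤ n * nl x := by
  induction n with
  | zero => simp [nl_one]
  | succ n ih =>
    rw [pow_succ]
    refine (nl_mul (by positivity) hx).trans ?_
    push_cast
    rw [add_mul, one_mul]
    gcongr

lemma nl_prod {ι : Type*} (s : Finset ι) (f : ι → ℝ) (hf : ∀ i, 0 ≤ f i) :
    nl (∏ i ∈ s, f i) ≤ ∑ i ∈ s, nl (f i) := by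
  classical
  induction s using Finset.induction_on with
  | empty => simp [nl_one]
  | insert a s ha ih =>
    rw [Finset.prod_insert ha, Finset.sum_insert ha]
    refine (nl_mul (hf _) (Finset.prod_nonneg fun i _ => hf i)).trans ?_
    gcongr

lemma nl_of_pos {x : ℝ} (hx : 0 < x) : nl x = ENNReal.ofReal (-Real.log x) := by
  simp [nl, not_le.mpr hx]

variable {M : Type*} [MeasurableSpace M]

lemma colorEntropy_fintype {S : Type*} [Fintype S] (μ : Measure M) (X : M → S) :
    colorEntropy μ X = ∑ i, Real.negMulLog (μ (X ⁻¹' {i})).toReal := by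
  unfold colorEntropy
  rw [tsum_fintype]

lemma colorEntropy_inj {S S' : Type*} [Countable S] [Countable S'] (μ : Measure M) (X : M → S)
    (g : S → S') (hg : Function.Injective g) :
    colorEntropy μ (fun x => g (X x)) = colorEntropy μ X := by
  unfold colorEntropy
  rw [← hg.tsum_eq]
  · apply tsum_congr
    intro s
    have : (fun x => g (X x)) ⁻¹' {g s} = X ⁻¹' {s} := by
      ext x; simp [hg.eq_iff]
    rw [this]
  · intro s hs
    by_contra hn
    apply hs
    have : (fun x => g (X x)) ⁻¹' {s} = ∅ := by
      ext x
      simp only [Set.mem_preimage, Set.mem_singleton_iff, Set.mem_empty_iff_false, iff_false]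
      intro h
      exact hn ⟨_, h⟩
    simp only [this]
    simp

lemma colorEntropy_nonneg {S : Type*} [Countable S] (μ : Measure M) [IsProbabilityMeasure μ] (X : M → S) :
    0 ≤ colorEntropy μ X := by
  unfold colorEntropy
  apply tsum_nonneg
  intro i
  apply Real.negMulLog_nonneg ENNReal.toReal_nonneg
  exact measureReal_le_one

lemma gibbs_point {x q : ℝ} (hx : 0 ≤ x) (hq : 0 ≤ q) (h : 0 < x → 0 < q) :
    Real.negMulLog x ≤ x * (-Real.log q) + (q - x) := by
  rcases hx.eq_or_lt with rfl | hx
  · simpa using hq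
  have hq := h hx
  have h1 := Real.log_le_sub_one_of_pos (show 0 < q / x by positivity)
  rw [Real.log_div hq.ne' hx.ne'] at h1
  unfold Real.negMulLog
  have h2 : x * (Real.log q - Real.log x) ≤ x * (q / x - 1) :=
    mul_le_mul_of_nonneg_left h1 hx.le
  have h3 : x * (q / x - 1) = q - x := by field_simp
  nlinarith

lemma lintegral_comp_fin {S : Type*} [Fintype S] (μ : Measure M) (X : M → S)
    (hX : ∀ s, MeasurableSet (X ⁻¹' {s})) (G : S → ℝ≥0∞) :
    ∫⁻ y, G (X y) ∂μ = ∑ s, G s * μ (X ⁻¹' {s}) := by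
  let : MeasurableSpace S := ⊤
  have hm : Measurable X := measurable_to_countable' hX
  rw [← lintegral_map (f := G) (g := X) (measurable_from_top) hm, lintegral_fintype]
  apply Finset.sum_congr rfl
  intro s _
  rw [Measure.map_apply hm (measurableSet_singleton s)]

lemma sum_real_eq_one {S : Type*} [Fintype S] (μ : Measure M) [IsProbabilityMeasure μ] (X : M → S)
    (hX : ∀ s, MeasurableSet (X ⁻¹' {s})) : ∑ s, (μ (X ⁻¹' {s})).toReal = 1 := by
  have h := lintegral_comp_fin μ X hX (fun _ => 1)
  simp only [lintegral_const, measure_univ, mul_one, one_mul] at h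
  rw [← ENNReal.toReal_sum (fun _ _ => measure_ne_top _ _), ← h]
  simp

/-- Gibbs inequality. -/
lemma gibbs {S : Type*} [Fintype S] (μ : Measure M) [IsProbabilityMeasure μ] (X : M → S)
    (hX : ∀ s, MeasurableSet (X ⁻¹' {s})) (P : S → ℝ) (hP : ∀ s, 0 ≤ P s) (hPs : ∑ s, P s ≤ 1) :
    ENNReal.ofReal (colorEntropy μ X) ≤ ∫⁻ y, nl (P (X y)) ∂μ := by
  rw [lintegral_comp_fin μ X hX (fun s => nl (P s))]
  by_cases h : ∀ s, 0 < (μ (X ⁻¹' {s})).toReal → 0 < P s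
  · have hle1 : ∀ s, P s ≤ 1 := fun s =>
      (Finset.single_le_sum (fun s _ => hP s) (Finset.mem_univ s)).trans hPs
    have key : colorEntropy μ X ≤ ∑ s, (μ (X ⁻¹' {s})).toReal * (-Real.log (P s)) := by
      rw [colorEntropy_fintype]
      calc _ ≤ ∑ s, ((μ (X ⁻¹' {s})).toReal * (-Real.log (P s)) + (P s - (μ (X ⁻¹' {s})).toReal)) :=
            Finset.sum_le_sum fun s _ => gibbs_point ENNReal.toReal_nonneg (hP s) (h s)
        _ ≤ _ := by
            rw [Finset.sum_add_distrib, Finset.sum_sub_distrib, sum_real_eq_one μ X hX]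
            linarith
    refine (ENNReal.ofReal_le_ofReal key).trans ?_
    rw [ENNReal.ofReal_sum_of_nonneg]
    · apply Finset.sum_le_sum
      intro s _
      rw [ENNReal.ofReal_mul ENNReal.toReal_nonneg, ENNReal.ofReal_toReal (measure_ne_top _ _), mul_comm]
      gcongr
      unfold nl
      split_ifs
      · exact le_top
      · exact le_rfl
    · intro s _
      apply mul_nonneg ENNReal.toReal_nonneg
      have := Real.log_nonpos (hP s) (hle1 s)
      linarith
  · push Not at h
    obtain ⟨s, h1, h2⟩ := h
    have : nl (P s) * μ (X ⁻¹' {s}) = ⊤ := by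
      have h3 : nl (P s) = ⊤ := by simp [nl, h2]
      rw [h3, ENNReal.top_mul]
      intro h4
      simp [h4] at h1
    have h5 := Finset.single_le_sum (f := fun s => nl (P s) * μ (X ⁻¹' {s}))
      (fun s _ => zero_le) (Finset.mem_univ s)
    rw [this] at h5
    rw [top_le_iff.mp h5]
    exact le_top

/-- The entropy as an integral of the information function. -/
lemma lintegral_nl_info {S : Type*} [Fintype S] (μ : Measure M) [IsProbabilityMeasure μ] (X : M → S)
    (hX : ∀ s, MeasurableSet (X ⁻¹' {s})) :
    ∫⁻ y, nl ((μ (X ⁻¹' {X y})).toReal) ∂μ = ENNReal.ofReal (colorEntropy μ X) := by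
  rw [lintegral_comp_fin μ X hX (fun s => nl ((μ (X ⁻¹' {s})).toReal)), colorEntropy_fintype,
    ENNReal.ofReal_sum_of_nonneg]
  · apply Finset.sum_congr rfl
    intro s _
    rcases (ENNReal.toReal_nonneg (a := μ (X ⁻¹' {s}))).eq_or_lt with h | h
    · rw [← h]
      have : μ (X ⁻¹' {s}) = 0 := by
        rcases (ENNReal.toReal_eq_zero_iff _).mp h.symm with h | h
        · exact h
        · exact absurd h (measure_ne_top _ _)
      rw [this]
      simp
    · rw [nl_of_pos h]
      conv_lhs => rw [← ENNReal.ofReal_toReal (measure_ne_top μ (X ⁻¹' {s}))]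
      rw [← ENNReal.ofReal_mul', Real.negMulLog]
      · congr 1
        rw [ENNReal.toReal_ofReal ENNReal.toReal_nonneg]
        ring
      · exact ENNReal.toReal_nonneg
  · intro s _
    exact Real.negMulLog_nonneg ENNReal.toReal_nonneg measureReal_le_one

lemma colorEntropy_le_log_card {S : Type*} [Fintype S] (μ : Measure M) [IsProbabilityMeasure μ] (X : M → S)
    (hX : ∀ s, MeasurableSet (X ⁻¹' {s})) : colorEntropy μ X ≤ Real.log (Fintype.card S) := by
  have hne : Nonempty M := μ.nonempty_of_neZero
  have hc : (0:ℝ) < Fintype.card S := by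
    have : 0 < Fintype.card S := Fintype.card_pos_iff.mpr ⟨X hne.some⟩
    exact_mod_cast this
  have := gibbs μ X hX (fun _ => 1 / (Fintype.card S : ℝ)) (fun _ => by positivity)
    (by simp [hc.ne'])
  rw [lintegral_const, measure_univ, mul_one, nl_of_pos (by positivity)] at this
  rw [ENNReal.ofReal_le_ofReal_iff] at this
  · simpa using this
  · have : (1:ℝ) ≤ Fintype.card S := by
      have : 0 < Fintype.card S := Fintype.card_pos_iff.mpr ⟨X hne.some⟩
      exact_mod_cast this
    simp only [one_div, Real.log_inv, neg_neg]
    exact Real.log_nonneg this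

end NL


section Setup

set_option linter.unusedSectionVars false
open scoped ENNReal

variable {M : Type*} [MeasurableSpace M]

structure GoodPt (Φ Ψ : ℝ → M → M) (σ : M → ℝ → ℝ) (y : M) : Prop where
  mono : StrictMono (σ y)
  surj : Function.Surjective (σ y)
  zero : σ y 0 = 0
  coc : ∀ s u, σ y (s + u) = σ y s + σ (Ψ s y) u
  orbit : ∀ s, Φ (σ y s) y = Ψ s y

structure TC (Φ Ψ : ℝ → M → M) (μ ν : Measure M) (σ : M → ℝ → ℝ) (R : ℝ) : Prop where
  Φ0 : Φ 0 = id
  Φadd : ∀ s t, Φ (s + t) = Φ s ∘ Φ t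
  Φm : Measurable fun p : ℝ × M => Φ p.1 p.2
  Ψ0 : Ψ 0 = id
  Ψadd : ∀ s t, Ψ (s + t) = Ψ s ∘ Ψ t
  Ψm : Measurable fun p : ℝ × M => Ψ p.1 p.2
  Ψinv : ∀ t, MeasurePreserving (Ψ t) ν ν
  Rpos : 0 < R
  good : ∀ᵐ y ∂ν, GoodPt Φ Ψ σ y
  meas : ∀ s, MeasurableSet {p : M × ℝ | p.2 < σ p.1 s}
  formula : ∀ F : M → ℝ≥0∞, Measurable F → ∀ m : ℕ,
    ∫⁻ y, (∫⁻ t in {t : ℝ | 0 < t ∧ t < σ y m}, F (Φ t y)) ∂ν = ENNReal.ofReal (m / R) * ∫⁻ x, F x ∂μ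

lemma flow_iter {Φ : ℝ → M → M} (Φ0 : Φ 0 = id) (Φadd : ∀ s t, Φ (s + t) = Φ s ∘ Φ t) (l : ℕ) :
    (Φ 1)^[l] = Φ l := by
  induction l with
  | zero => simp [Φ0]
  | succ l ih =>
    rw [Function.iterate_succ', ih]
    push_cast
    rw [add_comm, Φadd]

def Bad1 {N : ℕ} (Ψ : ℝ → M → M) (c : M → Fin N) (p : ℕ) : Set M :=
  {y | ENNReal.ofReal (1 / (2 * p)) ≤
    volume {u : ℝ | u ∈ Set.Icc (-(1 / p : ℝ)) (1 / p) ∧ c (Ψ u y) ≠ c y}}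

def Bad2 (σ : M → ℝ → ℝ) (a A : ℕ) : Set M := {y | -(a:ℝ) < σ y (-(A:ℝ))}

open Classical in
noncomputable def maj {N : ℕ} (Ψ : ℝ → M → M) (c : M → Fin N) (p A : ℕ) (x : M) :
    Fin (A * p) → Fin N → Bool := fun i col =>
  decide (ENNReal.ofReal (1 / (2 * p)) <
    volume {s : ℝ | s ∈ Set.Ico ((i : ℝ) / p) ((i + 1 : ℝ) / p) ∧ c (Ψ s x) = col})

open Classical in
noncomputable def dec {N B : ℕ} (d0 : Fin N) (q : Fin B → Fin N → Bool) (i : ℕ) : Fin N :=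
  if h : ∃ col, ∃ hi : i < B, q ⟨i, hi⟩ col = true then h.choose else d0

lemma meas_flow_slice {N : ℕ} {Ψ : ℝ → M → M} (hm : Measurable fun p : ℝ × M => Ψ p.1 p.2)
    {c : M → Fin N} (hc : Measurable c) (x : M) : Measurable fun s : ℝ => c (Ψ s x) :=
  hc.comp (hm.comp (measurable_id.prodMk measurable_const))

lemma dec_maj {N : ℕ} {Ψ : ℝ → M → M} (Ψadd : ∀ s t, Ψ (s + t) = Ψ s ∘ Ψ t)
    (hm : Measurable fun p : ℝ × M => Ψ p.1 p.2)
    {c : M → Fin N} (hc : Measurable c) (d0 : Fin N) (p A : ℕ) (hp : 0 < p) (x : M) (s0 : ℝ) (i : ℕ)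
    (hi : i < A * p) (h1 : (i : ℝ) / p ≤ s0) (h2 : s0 < (i + 1 : ℝ) / p)
    (hb : Ψ s0 x ∉ Bad1 Ψ c p) : dec d0 (maj Ψ c p A x) i = c (Ψ s0 x) := by
  have hp' : (0:ℝ) < p := by exact_mod_cast hp
  set J : Set ℝ := Set.Ico ((i : ℝ) / p) ((i + 1 : ℝ) / p) with hJ
  have hvJ : volume J = ENNReal.ofReal (1 / p) := by
    rw [hJ, Real.volume_Ico]; congr 1; field_simp; ring
  have hms := meas_flow_slice hm hc x
  have hbad : volume {s : ℝ | s ∈ J ∧ c (Ψ s x) ≠ c (Ψ s0 x)} < ENNReal.ofReal (1 / (2 * p)) := by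
    have hb' := hb
    simp only [Bad1, Set.mem_ofPred_eq, not_le] at hb'
    refine lt_of_le_of_lt ?_ hb'
    rw [← measure_preimage_add_right volume s0]
    apply measure_mono
    rintro u ⟨hu, hu2⟩
    have hu1 : (i : ℝ) / p ≤ u + s0 := hu.1
    have hu3 : u + s0 < (i + 1 : ℝ) / p := hu.2
    have e : (i + 1 : ℝ) / p = i / p + 1 / p := by ring
    refine ⟨⟨by linarith, by linarith⟩, ?_⟩
    rw [Ψadd] at hu2
    exact hu2
  have hgood : ENNReal.ofReal (1 / (2 * p)) < volume {s : ℝ | s ∈ J ∧ c (Ψ s x) = c (Ψ s0 x)} := by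
    by_contra hcon
    push Not at hcon
    have : volume J ≤ volume {s : ℝ | s ∈ J ∧ c (Ψ s x) = c (Ψ s0 x)} +
        volume {s : ℝ | s ∈ J ∧ c (Ψ s x) ≠ c (Ψ s0 x)} := by
      refine le_trans (measure_mono ?_) (measure_union_le _ _)
      intro s hs
      by_cases h : c (Ψ s x) = c (Ψ s0 x)
      · exact Or.inl ⟨hs, h⟩
      · exact Or.inr ⟨hs, h⟩
    have h3 : volume J < ENNReal.ofReal (1 / (2 * p)) + ENNReal.ofReal (1 / (2 * p)) :=
      this.trans_lt (ENNReal.add_lt_add_of_le_of_lt (ne_top_of_le_ne_top ENNReal.ofReal_ne_top hcon) hcon hbad)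
    rw [hvJ, ← ENNReal.ofReal_add (by positivity) (by positivity)] at h3
    have : (1:ℝ) / p = 1 / (2 * p) + 1 / (2 * p) := by field_simp; ring
    rw [this] at h3
    exact lt_irrefl _ h3
  have hex : ∃ col, ∃ hi : i < A * p, maj Ψ c p A x ⟨i, hi⟩ col = true :=
    ⟨c (Ψ s0 x), hi, by simp only [maj, decide_eq_true_eq]; exact hgood⟩
  have key : ∀ col, (∃ hi : i < A * p, maj Ψ c p A x ⟨i, hi⟩ col = true) → col = c (Ψ s0 x) := by
    rintro col ⟨hi', hq⟩
    by_contra hne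
    simp only [maj, decide_eq_true_eq] at hq
    refine lt_asymm hq (lt_of_le_of_lt (measure_mono ?_) hbad)
    rintro s ⟨hs1, hs2⟩
    exact ⟨hs1, by rw [hs2]; exact hne⟩
  unfold dec
  rw [dif_pos hex]
  exact key _ hex.choose_spec

open Classical in
noncomputable def predL {N n B p : ℕ} (d0 : Fin N) (a k : ℕ)
    (S : (Fin n → Fin B → Fin N → Bool) × (Fin k → Fin p)) (l v : ℕ) : Fin N :=
  if h : l < k ∧ l * a < n then dec d0 (S.1 ⟨l * a, h.2⟩) ((S.2 ⟨l, h.1⟩ : ℕ) + p * v) else d0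

noncomputable def nameQ {Q : Type*} (T : M → M) (q : M → Q) (n : ℕ) (x : M) : Fin n → Q :=
  fun i => q (T^[(i : ℕ)] x)

lemma decode {N : ℕ} {Φ Ψ : ℝ → M → M} {μ ν : Measure M} {σ : M → ℝ → ℝ} {R : ℝ}
    (h : TC Φ Ψ μ ν σ R) {c : M → Fin N} (hc : Measurable c) (d0 : Fin N) (p A a k n m : ℕ)
    (hp : 0 < p) (ha : 0 < a) (hk : 0 < k) (hn : k * a ≤ n) (y : M) (hy : GoodPt Φ Ψ σ y)
    (t0 : ℝ) (ht0 : 0 < t0) (ht1 : t0 < k * a) :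
    ∃ (K : ℕ) (s : ℕ → (Fin n → Fin (A * p) → Fin N → Bool) × (Fin k → Fin p)) (β : ℕ → ℕ),
      Monotone β ∧ (∀ j < m, β j ≤ k * K) ∧ (∀ i < K, t0 + i * (k * a) < σ y m) ∧
      (∀ i, (s i).1 = nameQ (Φ 1) (maj Ψ c p A) n (Φ (t0 + i * (k * a)) y)) ∧
      ∀ j < m, c (Ψ j y) ≠ what d0 (predL d0 a k) k s β j →
        (σ y j < k * a ∨ Ψ j y ∈ Bad1 Ψ c p ∨ Ψ j y ∈ Bad2 σ a A) := by
  have ha' : (0:ℝ) < a := by exact_mod_cast ha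
  have hk' : (0:ℝ) < k := by exact_mod_cast hk
  have hp' : (0:ℝ) < p := by exact_mod_cast hp
  have hb : (0:ℝ) < k * a := by positivity
  choose inv hinv using hy.surj
  set K := ⌈(σ y m - t0) / (k * a)⌉₊ with hK
  set s : ℕ → (Fin n → Fin (A * p) → Fin N → Bool) × (Fin k → Fin p) := fun i =>
    (nameQ (Φ 1) (maj Ψ c p A) n (Φ (t0 + i * (k * a)) y),
     fun l => ⟨⌊p * ((⌈inv (t0 + i * (k * a) + l * a)⌉₊ : ℝ) - inv (t0 + i * (k * a) + l * a))⌋₊ % p,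
      Nat.mod_lt _ hp⟩) with hs
  set β : ℕ → ℕ := fun j => if σ y j < t0 then 0 else ⌊(σ y j - t0) / a⌋₊ + 1 with hβ
  have hmono : ∀ i j : ℕ, i ≤ j → σ y i ≤ σ y j := fun i j hij =>
    hy.mono.monotone (by exact_mod_cast hij)
  have hgK : ∀ j < m, ¬ σ y j < t0 → ⌊(σ y j - t0) / a⌋₊ / k < K := by
    intro j hj hjt
    rw [← Nat.floor_div_natCast, hK, Nat.lt_ceil]
    have h1 : σ y j < σ y m := hy.mono (by exact_mod_cast hj)
    push Not at hjt
    have h2 : 0 ≤ (σ y j - t0) / a / k := by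
      have : 0 ≤ σ y j - t0 := by linarith
      positivity
    refine lt_of_le_of_lt (Nat.floor_le h2) ?_
    rw [div_div, mul_comm (a:ℝ)]
    exact div_lt_div_of_pos_right (by linarith) hb
  refine ⟨K, s, β, ?_, ?_, ?_, ?_, ?_⟩
  · intro i j hij
    simp only [hβ]
    have := hmono i j hij
    split_ifs with h1 h2 h2
    · exact le_rfl
    · exact Nat.zero_le _
    · linarith
    · gcongr
  · intro j hj
    simp only [hβ]
    split_ifs with h1
    · exact Nat.zero_le _
    · have := hgK j hj h1
      rw [Nat.div_lt_iff_lt_mul hk, mul_comm] at this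
      exact this
  · intro i hi
    rw [hK, Nat.lt_ceil, lt_div_iff₀ hb] at hi
    linarith
  · intro i
    rfl
  · intro j hj hne
    by_contra hcon
    push Not at hcon
    obtain ⟨hc1, hc2, hc3⟩ := hcon
    have hjt : ¬ σ y j < t0 := by linarith
    apply hne
    set g := ⌊(σ y j - t0) / a⌋₊ with hg
    have hβj : β j = g + 1 := by simp only [hβ, hjt, if_false]; rfl
    have hpos : 0 ≤ (σ y j - t0) / a := by
      have : 0 ≤ σ y j - t0 := by linarith
      positivity
    have hg1 : t0 + g * a ≤ σ y j := by
      have := Nat.floor_le hpos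
      rw [← hg, le_div_iff₀ ha'] at this
      linarith
    have hg2 : σ y j < t0 + g * a + a := by
      have := Nat.lt_floor_add_one ((σ y j - t0) / a)
      rw [← hg, div_lt_iff₀ ha'] at this
      linarith
    set t' := t0 + g * a with ht'
    set s' := inv t' with hs'
    have hσs : σ y s' = t' := hinv t'
    have ht'pos : 0 < t' := by positivity
    have hs'pos : 0 < s' := by
      rw [← hy.mono.lt_iff_lt, hy.zero, hσs]; exact ht'pos
    have hle : ∀ j' : ℕ, t' ≤ σ y j' ↔ ⌈s'⌉₊ ≤ j' := by
      intro j'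
      rw [← hσs, hy.mono.le_iff_le, Nat.ceil_le]
    have hcj : ⌈s'⌉₊ ≤ j := (hle j).mp hg1
    have hv : vpos β j = j - ⌈s'⌉₊ := by
      unfold vpos
      have : (Finset.range j).filter (fun j' => β j' = β j) = Finset.Ico ⌈s'⌉₊ j := by
        ext j'
        simp only [Finset.mem_filter, Finset.mem_range, Finset.mem_Ico]
        rw [← hle j']
        constructor
        · rintro ⟨h1, h2⟩
          refine ⟨?_, h1⟩
          rw [hβj] at h2
          simp only [hβ] at h2
          split_ifs at h2 with h3
          have h4 : ⌊(σ y j' - t0) / a⌋₊ = g := by omega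
          have h5 : 0 ≤ (σ y j' - t0) / a := by
            have : 0 ≤ σ y j' - t0 := by linarith
            positivity
          have := Nat.floor_le h5
          rw [h4, le_div_iff₀ ha'] at this
          rw [ht']
          linarith
        · rintro ⟨h1, h2⟩
          refine ⟨h2, ?_⟩
          have h6 := hmono j' j h2.le
          have hga : 0 ≤ (g:ℝ) * a := by positivity
          have h3 : ¬ σ y j' < t0 := by rw [ht'] at h1; linarith
          rw [hβj]
          simp only [hβ, h3, if_false]
          congr 1
          have h5 : 0 ≤ (σ y j' - t0) / a := by
            have : 0 ≤ σ y j' - t0 := by linarith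
            positivity
          rw [Nat.floor_eq_iff h5, le_div_iff₀ ha', div_lt_iff₀ ha']
          constructor <;> [skip; skip] <;> rw [ht'] at * <;> linarith
      rw [this, Nat.card_Ico]
    set v := j - ⌈s'⌉₊ with hvdef
    have hjv : (j:ℝ) = ⌈s'⌉₊ + v := by
      rw [hvdef, Nat.cast_sub hcj]; ring
    set θ : ℝ := (⌈s'⌉₊ : ℝ) - s' with hθ
    have hθ0 : 0 ≤ θ := by have := Nat.le_ceil s'; linarith
    have hθ1 : θ < 1 := by have := Nat.ceil_lt_add_one hs'pos.le; linarith
    have hel : ⌊p * θ⌋₊ < p := by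
      rw [Nat.floor_lt (by positivity)]
      nlinarith
    -- the truncation
    have hvA : v < A := by
      by_contra hvA
      push Not at hvA
      apply hc3
      have hAr : (A:ℝ) ≤ v := by exact_mod_cast hvA
      have h1 := hy.coc j (-(A:ℝ))
      have h2 : t' ≤ σ y (j + -(A:ℝ)) := by
        rw [← hσs, hy.mono.le_iff_le]
        linarith
      change -(a:ℝ) < σ (Ψ j y) (-(A:ℝ))
      linarith
    have hmodlt : g % k < k := Nat.mod_lt _ hk
    have hlan : g % k * a < n := by
      have : g % k * a < k * a := Nat.mul_lt_mul_of_pos_right hmodlt ha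
      omega
    have hdm : ((g / k : ℕ) : ℝ) * k + ((g % k : ℕ) : ℝ) = g := by
      have := Nat.div_add_mod' g k
      exact_mod_cast this
    have htt : t0 + ((g / k : ℕ) : ℝ) * (k * a) + ((g % k : ℕ) : ℝ) * a = t' := by
      rw [ht', ← hdm]; ring
    have hname : (s (g / k)).1 ⟨g % k * a, hlan⟩ = maj Ψ c p A (Φ t' y) := by
      simp only [hs, nameQ]
      rw [flow_iter h.Φ0 h.Φadd, ← htt, add_comm (t0 + _), h.Φadd (((g % k : ℕ) : ℝ) * a)]
      push_cast
      rfl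
    have hph : ((s (g / k)).2 ⟨g % k, hmodlt⟩ : ℕ) = ⌊p * θ⌋₊ := by
      simp only [hs]
      rw [htt]
      exact Nat.mod_eq_of_lt hel
    have hx : Φ t' y = Ψ s' y := by rw [← hσs, hy.orbit]
    have hjx : Ψ j y = Ψ (θ + v) (Φ t' y) := by
      rw [hx]
      have : (j:ℝ) = (θ + v) + s' := by rw [hjv, hθ]; ring
      rw [this, h.Ψadd]
      rfl
    unfold what
    rw [hβj, hv]
    simp only [Nat.add_sub_cancel, Nat.succ_ne_zero, if_false]
    unfold predL
    rw [dif_pos ⟨hmodlt, hlan⟩, hname, hph, hjx]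
    symm
    have hfl := Nat.floor_le (show 0 ≤ p * θ by positivity)
    have hfl2 := Nat.lt_floor_add_one (p * θ)
    apply dec_maj h.Ψadd h.Ψm hc d0 p A hp
    · calc ⌊p * θ⌋₊ + p * v < p + p * v := by omega
        _ = (v + 1) * p := by ring
        _ ≤ A * p := Nat.mul_le_mul_right _ hvA
    · rw [div_le_iff₀ hp']
      push_cast
      nlinarith
    · rw [lt_div_iff₀ hp']
      push_cast
      nlinarith
    · rw [← hjx]
      exact hc2

end Setup


section Integrate
open scoped ENNReal
set_option linter.unusedSectionVars false

variable {M : Type*} [MeasurableSpace M]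

lemma tile (h : ℝ → ℝ≥0∞) (hh : Measurable h) (b : ℝ) (hb : 0 < b) :
    ∫⁻ t in Set.Ioo 0 b, ∑' i : ℕ, h (t + i * b) ≤ ∫⁻ t, h t := by
  rw [lintegral_tsum (fun i => by fun_prop)]
  have e : ∀ i : ℕ, ∫⁻ t in Set.Ioo 0 b, h (t + i * b)
      = ∫⁻ t in Set.Ioo ((i:ℝ) * b) (i * b + b), h t := by
    intro i
    have hp := measurePreserving_add_right (volume : Measure ℝ) ((i:ℝ) * b)
    rw [← hp.setLIntegral_comp_preimage measurableSet_Ioo hh]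
    congr 2
    ext t
    simp only [Set.mem_Ioo, Set.mem_preimage]
    constructor <;> rintro ⟨h1, h2⟩ <;> constructor <;> linarith
  simp only [e]
  rw [← lintegral_iUnion (fun i => measurableSet_Ioo)]
  · exact setLIntegral_le_lintegral _ _
  · have key : ∀ i j : ℕ, i < j → Disjoint (Set.Ioo ((i:ℝ) * b) (i * b + b)) (Set.Ioo ((j:ℝ) * b) (j * b + b)) := by
      intro i j hij
      rw [Set.disjoint_left]
      rintro t ⟨h1, h2⟩ ⟨h3, h4⟩
      have : (i:ℝ) + 1 ≤ j := by exact_mod_cast hij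
      nlinarith
    intro i j hij
    rcases lt_or_gt_of_ne hij with h1 | h1
    · exact key i j h1
    · exact (key j i h1).symm

lemma meas_flow {Φ : ℝ → M → M} (hm : Measurable fun p : ℝ × M => Φ p.1 p.2) (t : ℝ) :
    Measurable (Φ t) := hm.comp (measurable_const.prodMk measurable_id)

lemma meas_name {Q : Type*} [MeasurableSpace Q] {T : M → M} (hT : Measurable T) {q : M → Q} (hq : Measurable q)
    (n : ℕ) : Measurable (nameQ T q n) := by
  unfold nameQ
  exact measurable_pi_lambda _ fun i => hq.comp (hT.iterate i)

lemma meas_Bad1 {N : ℕ} {Ψ : ℝ → M → M} (hm : Measurable fun p : ℝ × M => Ψ p.1 p.2)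
    {c : M → Fin N} (hc : Measurable c) (p : ℕ) : MeasurableSet (Bad1 Ψ c p) := by
  unfold Bad1
  apply measurableSet_le measurable_const
  have hs : MeasurableSet {q : M × ℝ | q.2 ∈ Set.Icc (-(1 / p : ℝ)) (1 / p) ∧ c (Ψ q.2 q.1) ≠ c q.1} := by
    apply MeasurableSet.inter
    · exact measurable_snd measurableSet_Icc
    · apply MeasurableSet.compl
      apply measurableSet_eq_fun
      · exact hc.comp (hm.comp measurable_swap)
      · exact hc.comp measurable_fst
  exact measurable_measure_prodMk_left hs

lemma meas_maj {N : ℕ} {Ψ : ℝ → M → M} (hm : Measurable fun p : ℝ × M => Ψ p.1 p.2)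
    {c : M → Fin N} (hc : Measurable c) (p A : ℕ) : Measurable (maj Ψ c p A) := by
  apply measurable_pi_lambda
  intro i
  apply measurable_pi_lambda
  intro col
  apply measurable_to_bool
  have : (fun x => maj Ψ c p A x i col) ⁻¹' {true} = {x | ENNReal.ofReal (1 / (2 * p)) <
    volume {s : ℝ | s ∈ Set.Ico ((i : ℝ) / p) ((i + 1 : ℝ) / p) ∧ c (Ψ s x) = col}} := by
    ext x
    simp [maj]
  rw [this]
  apply measurableSet_lt measurable_const
  have hs : MeasurableSet {q : M × ℝ | q.2 ∈ Set.Ico ((i : ℝ) / p) ((i + 1 : ℝ) / p) ∧ c (Ψ q.2 q.1) = col} := by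
    apply MeasurableSet.inter
    · exact measurable_snd measurableSet_Ico
    · apply measurableSet_eq_fun
      · exact hc.comp (hm.comp measurable_swap)
      · exact measurable_const
  exact measurable_measure_prodMk_left hs

variable {Φ Ψ : ℝ → M → M} {μ ν : Measure M} {σ : M → ℝ → ℝ} {R : ℝ}

lemma TC.meas_sigma (h : TC Φ Ψ μ ν σ R) (s : ℝ) : Measurable fun y => σ y s := by
  apply measurable_of_Ioi
  intro t
  exact (measurable_id.prodMk measurable_const : Measurable fun y : M => (y, t)) (h.meas s)

lemma nl_cost {ε δ : ℝ} (h0 : 0 < ε) (h1 : ε < 1) (hd0 : 0 < δ) (hd1 : δ < 1) (N : ℕ)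
    (k m K e : ℕ) (f : ℕ → ℝ) (hf : ∀ i, 0 ≤ f i) (P : ℝ)
    (hP : (1 / 2 : ℝ) ^ (K + 1) * ((∏ i ∈ Finset.range K, f i) * ((1 - δ) ^ m * δ ^ (k * K)) *
      ((1 - ε) ^ m * (ε / N) ^ e)) ≤ P) :
    nl P ≤ (nl (1 / 2) + m * (nl (1 - δ) + nl (1 - ε))) + e * nl (ε / N) +
      ∑ i ∈ Finset.range K, (nl (1 / 2) + k * nl δ + nl (f i)) := by
  have a1 : 0 ≤ 1 - ε := by linarith
  have a2 : 0 ≤ 1 - δ := by linarith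
  have hpr : 0 ≤ ∏ i ∈ Finset.range K, f i := Finset.prod_nonneg fun i _ => hf i
  have hcalc : nl P ≤ ((K + 1 : ℕ) : ℝ≥0∞) * nl (1 / 2) + ((∑ i ∈ Finset.range K, nl (f i)) +
      (m * nl (1 - δ) + ((k * K : ℕ) : ℝ≥0∞) * nl δ) + (m * nl (1 - ε) + e * nl (ε / N))) := by
    refine (nl_anti hP).trans ?_
    refine (nl_mul (by positivity) (by positivity)).trans (add_le_add (nl_pow (by positivity) _) ?_)
    refine (nl_mul (by positivity) (by positivity)).trans (add_le_add ?_ ?_)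
    · refine (nl_mul (by positivity) (by positivity)).trans (add_le_add (nl_prod _ _ hf) ?_)
      exact (nl_mul (by positivity) (by positivity)).trans
        (add_le_add (nl_pow (by positivity) _) (nl_pow (by positivity) _))
    · exact (nl_mul (by positivity) (by positivity)).trans
        (add_le_add (nl_pow (by positivity) _) (nl_pow (by positivity) _))
  refine hcalc.trans (le_of_eq ?_)
  rw [Finset.sum_add_distrib]
  simp only [Finset.sum_const, Finset.card_range, nsmul_eq_mul]
  push_cast
  ring

lemma card_fin_le_sum {m : ℕ} (e : Finset (Fin m))
    (f : ℕ → ℝ≥0∞) (he : ∀ j ∈ e, 1 ≤ f j) : (e.card : ℝ≥0∞) ≤ ∑ j ∈ Finset.range m, f j := by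
  rw [Finset.sum_range]
  calc (e.card : ℝ≥0∞) = ∑ j ∈ e, 1 := by simp
    _ ≤ ∑ j ∈ e, f j := Finset.sum_le_sum he
    _ ≤ _ := Finset.sum_le_sum_of_subset (Finset.subset_univ _)

lemma entropy_bound [IsProbabilityMeasure μ] [IsProbabilityMeasure ν] {N : ℕ}
    (h : TC Φ Ψ μ ν σ R) {c : M → Fin N} (hc : Measurable c) {ε δ : ℝ}
    (h0 : 0 < ε) (h1 : ε < 1) (hd0 : 0 < δ) (hd1 : δ < 1) (p A a k n m : ℕ)
    (hp : 0 < p) (ha : 0 < a) (hk : 0 < k) (hn : k * a ≤ n) :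
    ENNReal.ofReal (colorEntropy ν (nameQ (Ψ 1) c m)) ≤
      (nl (1 / 2) + m * (nl (1 - δ) + nl (1 - ε))) +
      nl (ε / N) * (∑ j ∈ Finset.range m, (ν {y | σ y j < k * a} + ν (Bad1 Ψ c p) + ν (Bad2 σ a A))) +
      (ENNReal.ofReal (k * a))⁻¹ * (ENNReal.ofReal (m / R) *
        (nl (1 / 2) + k * nl δ + k * nl (1 / p) +
          ENNReal.ofReal (colorEntropy μ (nameQ (Φ 1) (maj Ψ c p A) n)))) := by
  have hne : Nonempty M := ν.nonempty_of_neZero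
  have d0 : Fin N := c hne.some
  have hb : (0:ℝ) < k * a := by
    have : 0 < k * a := by positivity
    exact_mod_cast this
  set X := nameQ (Ψ 1) c m with hX
  set Y := nameQ (Φ 1) (maj Ψ c p A) n with hY
  have hXm : Measurable X := meas_name (meas_flow h.Ψm 1) hc m
  have hYm : Measurable Y := meas_name (meas_flow h.Φm 1) (meas_maj h.Ψm hc p A) n
  have hXs : ∀ s, MeasurableSet (X ⁻¹' {s}) := fun s => hXm (measurableSet_singleton s)
  have hYs : ∀ s, MeasurableSet (Y ⁻¹' {s}) := fun s => hYm (measurableSet_singleton s)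
  have hpR : (0:ℝ) < p := by exact_mod_cast hp
  set π : (Fin n → Fin (A * p) → Fin N → Bool) × (Fin k → Fin p) → ℝ := fun S =>
    (μ (Y ⁻¹' {S.1})).toReal * (1 / p) ^ k with hπ
  have hπ0 : ∀ S, 0 ≤ π S := fun S => by simp only [hπ]; positivity
  have hπs : ∑ S, π S ≤ 1 := by
    rw [Fintype.sum_prod_type]
    simp only [hπ, Finset.sum_const, Finset.card_univ, Fintype.card_fun, Fintype.card_fin, nsmul_eq_mul]
    rw [← Finset.mul_sum, ← Finset.sum_mul, sum_real_eq_one μ Y hYs]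
    push_cast
    rw [one_mul, ← mul_pow, mul_one_div_cancel hpR.ne', one_pow]
  have t00 : (Fin n → Fin (A * p) → Fin N → Bool) × (Fin k → Fin p) :=
    (fun _ _ _ => true, fun _ => ⟨0, hp⟩)
  obtain ⟨P, hP0, hPs, hP⟩ := coding h0 h1 hd0 hd1 d0 t00 π hπ0 hπs (predL d0 a k) k m hk
  refine (gibbs ν X hXs P hP0 hPs).trans ?_
  set F : M → ℝ≥0∞ := fun x => nl (1 / 2) + k * nl δ + k * nl (1 / p) + nl ((μ (Y ⁻¹' {Y x})).toReal) with hF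
  have hFm : Measurable F := by
    apply Measurable.const_add
    have : Measurable fun s => nl ((μ (Y ⁻¹' {s})).toReal) := measurable_of_finite _
    exact this.comp hYm
  set D : M → ℝ≥0∞ := fun y => ∑ j ∈ Finset.range m,
    (({y | σ y j < k * a} : Set M).indicator 1 y + (Ψ j ⁻¹' Bad1 Ψ c p).indicator 1 y
      + (Ψ j ⁻¹' Bad2 σ a A).indicator 1 y) with hD
  have hS1 : ∀ j : ℕ, MeasurableSet {y | σ y j < k * a} := fun j =>
    measurableSet_lt (h.meas_sigma j) measurable_const
  have hB1 : MeasurableSet (Bad1 Ψ c p) := meas_Bad1 h.Ψm hc p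
  have hB2 : MeasurableSet (Bad2 σ a A) := measurableSet_lt measurable_const (h.meas_sigma _)
  have hDm : Measurable D := by
    apply Finset.measurable_sum
    intro j _
    exact ((measurable_one.indicator (hS1 j)).add
      (measurable_one.indicator (meas_flow h.Ψm _ hB1))).add
      (measurable_one.indicator (meas_flow h.Ψm _ hB2))
  have hDi : ∫⁻ y, D y ∂ν = ∑ j ∈ Finset.range m, (ν {y | σ y j < k * a} + ν (Bad1 Ψ c p) + ν (Bad2 σ a A)) := by
    rw [lintegral_finsetSum]
    · apply Finset.sum_congr rfl
      intro j _
      rw [lintegral_add_right _ (measurable_one.indicator (meas_flow h.Ψm _ hB2)),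
        lintegral_add_right _ (measurable_one.indicator (meas_flow h.Ψm _ hB1)),
        lintegral_indicator_one (hS1 j), lintegral_indicator_one (meas_flow h.Ψm _ hB1),
        lintegral_indicator_one (meas_flow h.Ψm _ hB2), (h.Ψinv j).measure_preimage hB1.nullMeasurableSet,
        (h.Ψinv j).measure_preimage hB2.nullMeasurableSet]
    · intro j _
      exact ((measurable_one.indicator (hS1 j)).add
        (measurable_one.indicator (meas_flow h.Ψm _ hB1))).add
        (measurable_one.indicator (meas_flow h.Ψm _ hB2))
  set C0 : ℝ≥0∞ := nl (1 / 2) + m * (nl (1 - δ) + nl (1 - ε)) with hC0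
  have hpt : ∀ᵐ y ∂ν, nl (P (X y)) ≤ (C0 + nl (ε / N) * D y) +
      (ENNReal.ofReal (k * a))⁻¹ * ∫⁻ t in {t : ℝ | 0 < t ∧ t < σ y m}, F (Φ t y) := by
    filter_upwards [h.good] with y hy
    set H : ℝ → ℝ≥0∞ := ({t : ℝ | 0 < t ∧ t < σ y m}).indicator fun t => F (Φ t y) with hH
    have hset : MeasurableSet {t : ℝ | 0 < t ∧ t < σ y m} := measurableSet_Ioo
    have hHm : Measurable H :=
      (hFm.comp (h.Φm.comp (measurable_id.prodMk measurable_const))).indicator hset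
    have hall : ∀ t0 ∈ Set.Ioo (0:ℝ) (k * a), nl (P (X y)) ≤ (C0 + nl (ε / N) * D y) +
        ∑' i : ℕ, H (t0 + i * (k * a)) := by
      intro t0 ht0
      obtain ⟨K, s, β, hβ, hβK, hK, hs, herr⟩ := decode h hc d0 p A a k n m hp ha hk hn y hy t0 ht0.1 ht0.2
      have h3 := nl_cost h0 h1 hd0 hd1 N k m K _ (fun i => π (s i)) (fun i => hπ0 _) _
        (by simpa only [Fintype.card_fin] using hP K s β hβ hβK (X y))
      refine h3.trans ?_
      rw [mul_comm (_ : ℝ≥0∞) (nl (ε / N))]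
      gcongr
      · apply card_fin_le_sum
        intro j hj
        rw [Finset.mem_filter] at hj
        have hj2 := herr j j.2 (by
          have := hj.2
          simp only [hX, nameQ, flow_iter h.Ψ0 h.Ψadd] at this
          exact this)
        rcases hj2 with h4 | h4 | h4
        · have : ({y | σ y (j:ℕ) < k * a} : Set M).indicator (1 : M → ℝ≥0∞) y = 1 :=
            Set.indicator_of_mem (s := {y | σ y (j:ℕ) < k * a}) h4 1
          rw [this, add_assoc]
          exact le_self_add
        · have : (Ψ (j:ℕ) ⁻¹' Bad1 Ψ c p).indicator (1 : M → ℝ≥0∞) y = 1 :=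
            Set.indicator_of_mem (s := Ψ (j:ℕ) ⁻¹' Bad1 Ψ c p) h4 1
          rw [this, add_assoc, add_left_comm]
          exact le_self_add
        · have : (Ψ (j:ℕ) ⁻¹' Bad2 σ a A).indicator (1 : M → ℝ≥0∞) y = 1 :=
            Set.indicator_of_mem (s := Ψ (j:ℕ) ⁻¹' Bad2 σ a A) h4 1
          rw [this]
          exact le_add_self
      · refine le_trans ?_ (ENNReal.sum_le_tsum (Finset.range K))
        apply Finset.sum_le_sum
        intro i hi
        have hiK := hK i (Finset.mem_range.mp hi)
        have hmem : t0 + i * (k * a) ∈ {t : ℝ | 0 < t ∧ t < σ y m} := by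
          refine ⟨?_, hiK⟩
          have : (0:ℝ) ≤ i * (k * a) := by positivity
          linarith [ht0.1]
        rw [hH, Set.indicator_of_mem hmem]
        simp only [hF, hπ, hs i]
        rw [add_assoc (_ + _) ((k:ℝ≥0∞) * nl (1 / p)), add_comm ((k:ℝ≥0∞) * nl (1 / p))]
        gcongr
        refine (nl_mul (by positivity) (by positivity)).trans ?_
        gcongr
        exact nl_pow (by positivity) k
    have hintg : nl (P (X y)) * ENNReal.ofReal (k * a) ≤
        (C0 + nl (ε / N) * D y) * ENNReal.ofReal (k * a) + ∫⁻ t in {t : ℝ | 0 < t ∧ t < σ y m}, F (Φ t y) := by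
      have hv : volume (Set.Ioo (0:ℝ) (k * a)) = ENNReal.ofReal (k * a) := by
        rw [Real.volume_Ioo, sub_zero]
      calc nl (P (X y)) * ENNReal.ofReal (k * a) = ∫⁻ t0 in Set.Ioo (0:ℝ) (k * a), nl (P (X y)) := by
            rw [setLIntegral_const, hv]
        _ ≤ ∫⁻ t0 in Set.Ioo (0:ℝ) (k * a), ((C0 + nl (ε / N) * D y) + ∑' i : ℕ, H (t0 + i * (k * a))) :=
            setLIntegral_mono' measurableSet_Ioo hall
        _ = (C0 + nl (ε / N) * D y) * ENNReal.ofReal (k * a) +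
            ∫⁻ t0 in Set.Ioo (0:ℝ) (k * a), ∑' i : ℕ, H (t0 + i * (k * a)) := by
            rw [lintegral_add_left measurable_const, setLIntegral_const, hv]
        _ ≤ _ := by
            refine add_le_add le_rfl ?_
            refine (tile H hHm _ hb).trans (le_of_eq ?_)
            rw [hH, lintegral_indicator hset]
    have hb0 : ENNReal.ofReal (k * a) ≠ 0 := (ENNReal.ofReal_pos.mpr hb).ne'
    have hbt : ENNReal.ofReal (k * a) ≠ ⊤ := ENNReal.ofReal_ne_top
    calc nl (P (X y)) = (ENNReal.ofReal (k * a))⁻¹ * (nl (P (X y)) * ENNReal.ofReal (k * a)) := by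
          rw [mul_comm (nl _), ← mul_assoc, ENNReal.inv_mul_cancel hb0 hbt, one_mul]
      _ ≤ (ENNReal.ofReal (k * a))⁻¹ * ((C0 + nl (ε / N) * D y) * ENNReal.ofReal (k * a) +
          ∫⁻ t in {t : ℝ | 0 < t ∧ t < σ y m}, F (Φ t y)) := by gcongr
      _ = _ := by
          rw [mul_add, mul_comm (C0 + _), ← mul_assoc, ENNReal.inv_mul_cancel hb0 hbt, one_mul]
  refine (lintegral_mono_ae hpt).trans (le_of_eq ?_)
  rw [lintegral_add_left ((hDm.const_mul _).const_add _), lintegral_add_left measurable_const,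
    lintegral_const_mul _ hDm, lintegral_const, measure_univ, mul_one, hDi,
    lintegral_const_mul' _ _ (ENNReal.inv_ne_top.mpr (ENNReal.ofReal_pos.mpr hb).ne'), h.formula F hFm m]
  congr 3
  rw [hF, lintegral_add_left measurable_const, lintegral_const, measure_univ, mul_one, lintegral_nl_info μ Y hYs]

end Integrate


section Limits
open scoped ENNReal Topology
set_option linter.unusedSectionVars false

variable {M : Type*} [MeasurableSpace M]

lemma tendsto_zero_of_ae {X : Type*} [MeasurableSpace X] (ρ : Measure X) [IsFiniteMeasure ρ] (E : ℕ → Set X)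
    (hE : ∀ p, MeasurableSet (E p)) (h : ∀ᵐ x ∂ρ, ∀ᶠ p in atTop, x ∉ E p) :
    Tendsto (fun p => ρ (E p)) atTop (𝓝 0) := by
  have := tendsto_measure_of_ae_tendsto_indicator_of_isFiniteMeasure (μ := ρ) (A := ∅) (As := E)
    atTop MeasurableSet.empty hE (by
      filter_upwards [h] with x hx
      filter_upwards [hx] with p hp
      simp [hp])
  simpa using this

lemma bad1_point {N : ℕ} {Ψ : ℝ → M → M} (Ψadd : ∀ s t, Ψ (s + t) = Ψ s ∘ Ψ t)
    (hm : Measurable fun p : ℝ × M => Ψ p.1 p.2)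
    {c : M → Fin N} (hc : Measurable c) (y : M) :
    ∀ᵐ s : ℝ, ∀ᶠ p : ℕ in atTop, Ψ s y ∉ Bad1 Ψ c p := by
  have hms := meas_flow_slice hm hc y
  have hS : ∀ i : Fin N, MeasurableSet {s : ℝ | c (Ψ s y) ≠ i} := fun i =>
    (hms (measurableSet_singleton i)).compl
  have hall : ∀ᵐ s : ℝ, ∀ i : Fin N, Tendsto (fun r => volume ({s : ℝ | c (Ψ s y) ≠ i} ∩ Metric.closedBall s r) /
      volume (Metric.closedBall s r)) (𝓝[>] 0) (𝓝 (({s : ℝ | c (Ψ s y) ≠ i}).indicator 1 s)) := by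
    rw [ae_all_iff]
    intro i
    exact Besicovitch.ae_tendsto_measure_inter_div_of_measurableSet volume (hS i)
  filter_upwards [hall] with s hs
  have h1 := hs (c (Ψ s y))
  rw [Set.indicator_of_notMem (by simp)] at h1
  have hp : Tendsto (fun p : ℕ => (1:ℝ) / p) atTop (𝓝[>] 0) := by
    rw [tendsto_nhdsWithin_iff]
    refine ⟨tendsto_one_div_atTop_nhds_zero_nat, ?_⟩
    filter_upwards [eventually_gt_atTop 0] with p hp
    have : (0:ℝ) < p := by exact_mod_cast hp
    exact one_div_pos.mpr this
  have h2 := (h1.comp hp).eventually (gt_mem_nhds (show (0:ℝ≥0∞) < ENNReal.ofReal (1/4) by simp))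
  filter_upwards [h2, eventually_gt_atTop 0] with p hp hp0
  have hp0' : (0:ℝ) < p := by exact_mod_cast hp0
  simp only [Function.comp, Real.volume_closedBall] at hp
  have hne : ENNReal.ofReal (2 * (1 / p)) ≠ 0 := (ENNReal.ofReal_pos.mpr (by positivity)).ne'
  rw [ENNReal.div_lt_iff (Or.inl hne) (Or.inl ENNReal.ofReal_ne_top),
    ← ENNReal.ofReal_mul (by norm_num)] at hp
  simp only [Bad1, Set.mem_ofPred_eq, not_le]
  have e : (1:ℝ) / (2 * p) = 1 / 4 * (2 * (1 / p)) := by ring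
  rw [e]
  refine lt_of_le_of_lt ?_ hp
  rw [← measure_preimage_add_right volume s ({s_1 | c (Ψ s_1 y) ≠ c (Ψ s y)} ∩ Metric.closedBall s (1 / (p:ℝ)))]
  apply measure_mono
  rintro u ⟨hu, hu2⟩
  refine ⟨?_, ?_⟩
  · show c (Ψ (u + s) y) ≠ _
    rw [Ψadd]
    exact hu2
  · show u + s ∈ Metric.closedBall s (1 / (p:ℝ))
    rw [Metric.mem_closedBall, Real.dist_eq, abs_le]
    exact ⟨by linarith [hu.1], by linarith [hu.2]⟩

variable {Φ Ψ : ℝ → M → M} {μ ν : Measure M} {σ : M → ℝ → ℝ} {R : ℝ}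

lemma bad1_tendsto [IsProbabilityMeasure ν] {N : ℕ} (h : TC Φ Ψ μ ν σ R) {c : M → Fin N}
    (hc : Measurable c) : Tendsto (fun p => ν (Bad1 Ψ c p)) atTop (𝓝 0) := by
  set I : Set ℝ := Set.Icc 0 1 with hI
  have hvI : volume I = 1 := by simp [hI]
  have : IsProbabilityMeasure (volume.restrict I) := ⟨by simp [hvI]⟩
  set E : ℕ → Set (M × ℝ) := fun p => {q | Ψ q.2 q.1 ∈ Bad1 Ψ c p} with hE
  have hEm : ∀ p, MeasurableSet (E p) := fun p => (h.Ψm.comp measurable_swap) (meas_Bad1 h.Ψm hc p)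
  have key := tendsto_zero_of_ae (ν.prod (volume.restrict I)) E hEm (by
    have hset : MeasurableSet {q : M × ℝ | ∀ᶠ p in atTop, q ∉ E p} := by
      have : {q : M × ℝ | ∀ᶠ p in atTop, q ∉ E p} = ⋃ n : ℕ, ⋂ p : ℕ, ⋂ _ : n ≤ p, (E p)ᶜ := by
        ext q
        simp [eventually_atTop]
      rw [this]
      exact MeasurableSet.iUnion fun n => MeasurableSet.iInter fun p => MeasurableSet.iInter fun _ => (hEm p).compl
    rw [Measure.ae_prod_iff_ae_ae hset]
    refine Eventually.of_forall fun y => ae_restrict_of_ae ?_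
    exact bad1_point h.Ψadd h.Ψm hc y)
  refine key.congr fun p => ?_
  rw [Measure.prod_apply_symm (hEm p)]
  have : ∀ s : ℝ, ν ((fun x => (x, s)) ⁻¹' E p) = ν (Bad1 Ψ c p) := fun s =>
    (h.Ψinv s).measure_preimage (meas_Bad1 h.Ψm hc p).nullMeasurableSet
  simp [this]

lemma bad2_tendsto [IsProbabilityMeasure ν] (h : TC Φ Ψ μ ν σ R) (a : ℕ) :
    Tendsto (fun A => ν (Bad2 σ a A)) atTop (𝓝 0) := by
  apply tendsto_zero_of_ae
  · intro A
    exact measurableSet_lt measurable_const (h.meas_sigma _)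
  · filter_upwards [h.good] with y hy
    obtain ⟨s, hs⟩ := hy.surj (-(a:ℝ))
    obtain ⟨A0, hA0⟩ := exists_nat_ge (-s)
    filter_upwards [eventually_ge_atTop A0] with A hA
    simp only [Bad2, Set.mem_ofPred_eq, not_lt]
    rw [← hs]
    apply hy.mono.monotone
    have : (A0:ℝ) ≤ A := by exact_mod_cast hA
    linarith

lemma sig_tendsto [IsProbabilityMeasure ν] (h : TC Φ Ψ μ ν σ R) (b : ℝ) :
    Tendsto (fun j : ℕ => ν {y | σ y j < b}) atTop (𝓝 0) := by
  apply tendsto_zero_of_ae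
  · intro A
    exact measurableSet_lt (h.meas_sigma _) measurable_const
  · filter_upwards [h.good] with y hy
    obtain ⟨s, hs⟩ := hy.surj b
    obtain ⟨A0, hA0⟩ := exists_nat_ge s
    filter_upwards [eventually_ge_atTop A0] with A hA
    rw [not_lt, ← hs]
    apply hy.mono.monotone
    have : (A0:ℝ) ≤ A := by exact_mod_cast hA
    linarith

end Limits

section Asymp
open scoped ENNReal Topology
set_option linter.unusedSectionVars false

variable {M : Type*} [MeasurableSpace M]

noncomputable def ent {Q : Type*} [Countable Q] (T : M → M) (q : M → Q) (μ : Measure M) : ℝ :=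
  liminf (fun n : ℕ => colorEntropy μ (nameQ T q n) / n) atTop

lemma ent_inj {Q Q' : Type*} [Countable Q] [Countable Q'] (T : M → M) (q : M → Q) (g : Q → Q')
    (hg : Function.Injective g) (μ : Measure M) : ent T (fun x => g (q x)) μ = ent T q μ := by
  unfold ent
  congr 1
  funext n
  congr 1
  have hG : Function.Injective (fun (w : Fin n → Q) i => g (w i)) := by
    intro w w' hw
    funext i
    exact hg (congrFun hw i)
  exact colorEntropy_inj μ (nameQ T q n) _ hG

variable {Φ Ψ : ℝ → M → M} {μ ν : Measure M} {σ : M → ℝ → ℝ} {R : ℝ}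

lemma entropy_bound_real [IsProbabilityMeasure μ] [IsProbabilityMeasure ν] {N : ℕ}
    (h : TC Φ Ψ μ ν σ R) {c : M → Fin N} (hc : Measurable c) {ε : ℝ}
    (h0 : 0 < ε) (h1 : ε < 1) (p A a k n m : ℕ)
    (hp : 0 < p) (ha : 0 < a) (hk : 0 < k) (hn : k * a ≤ n) :
    colorEntropy ν (nameQ (Ψ 1) c m) ≤
      (Real.log 2 + m * (-Real.log (1 - ε) + -Real.log (1 - ε))) +
      Real.log (N / ε) * (∑ j ∈ Finset.range m, ((ν {y | σ y j < k * a}).toReal + (ν (Bad1 Ψ c p)).toReal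
        + (ν (Bad2 σ a A)).toReal)) +
      (k * a : ℝ)⁻¹ * ((m / R) *
        (Real.log 2 + k * Real.log (1 / ε) + k * Real.log p +
          colorEntropy μ (nameQ (Φ 1) (maj Ψ c p A) n))) := by
  have hne : Nonempty M := ν.nonempty_of_neZero
  have hN : 0 < N := (c hne.some).pos
  have hN' : (1:ℝ) ≤ N := by exact_mod_cast hN
  have hp' : (1:ℝ) ≤ p := by exact_mod_cast hp
  have hb : (0:ℝ) < k * a := by
    have : 0 < k * a := by positivity
    exact_mod_cast this
  have l2 : 0 ≤ Real.log 2 := Real.log_nonneg (by norm_num)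
  have le' : 0 ≤ -Real.log (1 - ε) := by
    have := Real.log_nonpos (x := 1 - ε) (by linarith) (by linarith); linarith
  have lN : 0 ≤ Real.log (N / ε) := Real.log_nonneg (by rw [le_div_iff₀ h0]; linarith)
  have li : 0 ≤ Real.log (1 / ε) := Real.log_nonneg (by rw [le_div_iff₀ h0]; linarith)
  have lp : 0 ≤ Real.log p := Real.log_nonneg hp'
  have hx := colorEntropy_nonneg μ (nameQ (Φ 1) (maj Ψ c p A) n)
  have hR := h.Rpos
  have hmR : 0 ≤ (m:ℝ) / R := by positivity
  have e1 : nl (1 / 2) = ENNReal.ofReal (Real.log 2) := by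
    rw [nl_of_pos (by norm_num)]; congr 1; rw [one_div, Real.log_inv, neg_neg]
  have e2 : nl (1 - ε) = ENNReal.ofReal (-Real.log (1 - ε)) := nl_of_pos (by linarith)
  have e3 : nl ε = ENNReal.ofReal (Real.log (1 / ε)) := by
    rw [nl_of_pos h0]; congr 1; rw [one_div, Real.log_inv]
  have e4 : nl (1 / p) = ENNReal.ofReal (Real.log p) := by
    rw [nl_of_pos (by positivity)]; congr 1; rw [one_div, Real.log_inv, neg_neg]
  have e5 : nl (ε / N) = ENNReal.ofReal (Real.log (N / ε)) := by
    rw [nl_of_pos (by positivity)]; congr 1; rw [← Real.log_inv, inv_div]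
  have es : ∑ j ∈ Finset.range m, (ν {y | σ y j < k * a} + ν (Bad1 Ψ c p) + ν (Bad2 σ a A)) =
      ENNReal.ofReal (∑ j ∈ Finset.range m, ((ν {y | σ y j < k * a}).toReal + (ν (Bad1 Ψ c p)).toReal
        + (ν (Bad2 σ a A)).toReal)) := by
    rw [ENNReal.ofReal_sum_of_nonneg (fun _ _ => by positivity)]
    refine Finset.sum_congr rfl fun j _ => ?_
    rw [ENNReal.ofReal_add (by positivity) (by positivity), ENNReal.ofReal_add (by positivity) (by positivity),
      ENNReal.ofReal_toReal (measure_ne_top _ _), ENNReal.ofReal_toReal (measure_ne_top _ _),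
      ENNReal.ofReal_toReal (measure_ne_top _ _)]
  have hs0 : 0 ≤ ∑ j ∈ Finset.range m, ((ν {y | σ y j < k * a}).toReal + (ν (Bad1 Ψ c p)).toReal
        + (ν (Bad2 σ a A)).toReal) := Finset.sum_nonneg fun _ _ => by positivity
  have hmain := entropy_bound h hc h0 h1 h0 h1 p A a k n m hp ha hk hn
  rw [e1, e2, e3, e4, e5, es, ← ENNReal.ofReal_inv_of_pos hb] at hmain
  rw [← ENNReal.ofReal_natCast m, ← ENNReal.ofReal_natCast k] at hmain
  rw [← ENNReal.ofReal_add le' le', ← ENNReal.ofReal_mul (by positivity),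
    ← ENNReal.ofReal_add l2 (by positivity), ← ENNReal.ofReal_mul lN,
    ← ENNReal.ofReal_mul (by positivity), ← ENNReal.ofReal_mul (by positivity),
    ← ENNReal.ofReal_add l2 (by positivity), ← ENNReal.ofReal_add (by positivity) (by positivity),
    ← ENNReal.ofReal_add (by positivity) (by positivity),
    ← ENNReal.ofReal_add (by positivity) hx, ← ENNReal.ofReal_mul hmR,
    ← ENNReal.ofReal_mul (by positivity),
    ← ENNReal.ofReal_add (by positivity) (by positivity)] at hmain
  exact (ENNReal.ofReal_le_ofReal_iff (by positivity)).mp hmain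

lemma bdd_below_rate [IsProbabilityMeasure μ] {Q : Type*} [Countable Q] (T : M → M) (q : M → Q) :
    IsBoundedUnder (· ≥ ·) atTop (fun n : ℕ => colorEntropy μ (nameQ T q n) / n) :=
  isBoundedUnder_of ⟨0, fun n => div_nonneg (colorEntropy_nonneg _ _) (by positivity)⟩

lemma bdd_above_rate [IsProbabilityMeasure μ] {Q : Type*} [Fintype Q] [MeasurableSpace Q]
    [MeasurableSingletonClass Q] {T : M → M} (hT : Measurable T) {q : M → Q} (hq : Measurable q) :
    IsBoundedUnder (· ≤ ·) atTop (fun n : ℕ => colorEntropy μ (nameQ T q n) / n) := by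
  refine isBoundedUnder_of ⟨Real.log (Fintype.card Q), fun n => ?_⟩
  have hne : Nonempty M := μ.nonempty_of_neZero
  have hc : (1:ℝ) ≤ Fintype.card Q := by
    have : 0 < Fintype.card Q := Fintype.card_pos_iff.mpr ⟨q hne.some⟩
    exact_mod_cast this
  rcases Nat.eq_zero_or_pos n with rfl | hn
  · simpa using Real.log_nonneg hc
  have h := colorEntropy_le_log_card μ (nameQ T q n) (fun s => meas_name hT hq n (measurableSet_singleton s))
  have hn' : (0:ℝ) < n := by exact_mod_cast hn
  rw [div_le_iff₀ hn']
  simp only [Fintype.card_fun, Fintype.card_fin] at h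
  push_cast at h
  rw [Real.log_pow] at h
  linarith

lemma bound_limit [IsProbabilityMeasure μ] [IsProbabilityMeasure ν] {N : ℕ}
    (h : TC Φ Ψ μ ν σ R) {c : M → Fin N} (hc : Measurable c) {ε : ℝ}
    (h0 : 0 < ε) (h1 : ε < 1) (p A a k n : ℕ)
    (hp : 0 < p) (ha : 0 < a) (hk : 0 < k) (hn : k * a ≤ n) :
    ent (Ψ 1) c ν ≤ (-Real.log (1 - ε) + -Real.log (1 - ε)) +
      Real.log (N / ε) * ((ν (Bad1 Ψ c p)).toReal + (ν (Bad2 σ a A)).toReal) +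
      (k * a : ℝ)⁻¹ * (R⁻¹ *
        (Real.log 2 + k * Real.log (1 / ε) + k * Real.log p +
          colorEntropy μ (nameQ (Φ 1) (maj Ψ c p A) n))) := by
  set X := (Real.log 2 + k * Real.log (1 / ε) + k * Real.log p +
          colorEntropy μ (nameQ (Φ 1) (maj Ψ c p A) n)) with hX
  set β := (ν (Bad1 Ψ c p)).toReal + (ν (Bad2 σ a A)).toReal with hβ
  set u : ℕ → ℝ := fun m => Real.log 2 * (m:ℝ)⁻¹ + (-Real.log (1 - ε) + -Real.log (1 - ε)) +
      Real.log (N / ε) * ((m:ℝ)⁻¹ * (∑ j ∈ Finset.range m, (ν {y | σ y j < k * a}).toReal) + β) +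
      (k * a : ℝ)⁻¹ * (R⁻¹ * X) with hu
  have hces : Tendsto (fun m : ℕ => (m:ℝ)⁻¹ * (∑ j ∈ Finset.range m, (ν {y | σ y j < k * a}).toReal)) atTop (𝓝 0) := by
    have := (ENNReal.tendsto_toReal ENNReal.zero_ne_top).comp (sig_tendsto h (k * a))
    exact this.cesaro
  have hlim : Tendsto u atTop (𝓝 (Real.log 2 * 0 + (-Real.log (1 - ε) + -Real.log (1 - ε)) +
      Real.log (N / ε) * (0 + β) + (k * a : ℝ)⁻¹ * (R⁻¹ * X))) := by
    refine (((tendsto_inv_atTop_nhds_zero_nat.const_mul _).add_const _).add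
      ((hces.add_const β).const_mul _)).add_const _
  have hle : ∀ᶠ m : ℕ in atTop, colorEntropy ν (nameQ (Ψ 1) c m) / m ≤ u m := by
    filter_upwards [eventually_gt_atTop 0] with m hm
    have hm' : (0:ℝ) < m := by exact_mod_cast hm
    rw [div_le_iff₀ hm']
    refine (entropy_bound_real h hc h0 h1 p A a k n m hp ha hk hn).trans (le_of_eq ?_)
    rw [← hX]
    have : ∑ j ∈ Finset.range m, ((ν {y | σ y j < k * a}).toReal + (ν (Bad1 Ψ c p)).toReal
        + (ν (Bad2 σ a A)).toReal) = (∑ j ∈ Finset.range m, (ν {y | σ y j < k * a}).toReal) + m * β := by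
      simp only [add_assoc]
      rw [Finset.sum_add_distrib]
      simp [hβ]
      ring
    rw [this, hu]
    have hR := h.Rpos
    field_simp
  have := liminf_le_liminf hle (bdd_below_rate _ _) hlim.isCoboundedUnder_ge
  rw [hlim.liminf_eq] at this
  simpa [ent] using this

lemma bound_limit2 [IsProbabilityMeasure μ] [IsProbabilityMeasure ν] {N : ℕ}
    (h : TC Φ Ψ μ ν σ R) {c : M → Fin N} (hc : Measurable c) {ε : ℝ}
    (h0 : 0 < ε) (h1 : ε < 1) (p A a : ℕ) (hp : 0 < p) (ha : 0 < a) :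
    R * (ent (Ψ 1) c ν - ((-Real.log (1 - ε) + -Real.log (1 - ε)) +
      Real.log (N / ε) * ((ν (Bad1 Ψ c p)).toReal + (ν (Bad2 σ a A)).toReal))) -
      (Real.log (1 / ε) + Real.log p) / a ≤ ent (Φ 1) (maj Ψ c p A) μ := by
  set B := ((-Real.log (1 - ε) + -Real.log (1 - ε)) +
      Real.log (N / ε) * ((ν (Bad1 Ψ c p)).toReal + (ν (Bad2 σ a A)).toReal)) with hB
  set L := Real.log (1 / ε) + Real.log p with hL
  set D := R * (ent (Ψ 1) c ν - B) - L / a with hD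
  have hR := h.Rpos
  have ha' : (0:ℝ) < a := by exact_mod_cast ha
  have hle : ∀ᶠ n : ℕ in atTop, D - (|D| * a + Real.log 2) * (n:ℝ)⁻¹ ≤
      colorEntropy μ (nameQ (Φ 1) (maj Ψ c p A) n) / n := by
    filter_upwards [eventually_ge_atTop a] with n hn
    have hn' : (0:ℝ) < n := by exact_mod_cast (lt_of_lt_of_le ha hn)
    have hk : 0 < n / a := Nat.div_pos hn ha
    have hk' : (0:ℝ) < (n / a : ℕ) := by exact_mod_cast hk
    have hkn : n / a * a ≤ n := Nat.div_mul_le_self n a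
    have hkn2 : n < n / a * a + a := by
      have := Nat.mod_lt n ha
      have := Nat.div_add_mod' n a
      omega
    have hmain := bound_limit h hc h0 h1 p A a (n / a) n hp ha hk hkn
    rw [← hB] at hmain
    set k := n / a
    set x := colorEntropy μ (nameQ (Φ 1) (maj Ψ c p A) n)
    have hknR : (k:ℝ) * a ≤ n := by exact_mod_cast hkn
    have hkn2R : (n:ℝ) < k * a + a := by exact_mod_cast hkn2
    have h2 : D * (k * a) ≤ Real.log 2 + x := by
      have h3 : ent (Ψ 1) c ν - B ≤ (k * a : ℝ)⁻¹ * (R⁻¹ *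
        (Real.log 2 + k * Real.log (1 / ε) + k * Real.log p + x)) := by linarith
      have h4 : (ent (Ψ 1) c ν - B) * (R * (k * a)) ≤
          (Real.log 2 + k * Real.log (1 / ε) + k * Real.log p + x) := by
        calc (ent (Ψ 1) c ν - B) * (R * (k * a)) ≤ (k * a : ℝ)⁻¹ * (R⁻¹ *
            (Real.log 2 + k * Real.log (1 / ε) + k * Real.log p + x)) * (R * (k * a)) := by
              gcongr
          _ = _ := by field_simp
      have h5 : D * (k * a) = (ent (Ψ 1) c ν - B) * (R * (k * a)) - k * L := by
        rw [hD]; field_simp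
      rw [h5, hL]
      linarith
    have h6 : D * n - |D| * a ≤ D * (k * a) := by
      have h7 : D * (n - k * a) ≤ |D| * a := by
        calc D * (n - k * a) ≤ |D| * (n - k * a) := by
              apply mul_le_mul_of_nonneg_right (le_abs_self D); linarith
          _ ≤ |D| * a := by apply mul_le_mul_of_nonneg_left _ (abs_nonneg D); linarith
      linarith
    rw [le_div_iff₀ hn']
    have : (D - (|D| * a + Real.log 2) * (n:ℝ)⁻¹) * n = D * n - (|D| * a + Real.log 2) := by
      field_simp
    rw [this]; linarith
  have hlim : Tendsto (fun n : ℕ => D - (|D| * a + Real.log 2) * (n:ℝ)⁻¹) atTop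
      (𝓝 (D - (|D| * a + Real.log 2) * 0)) :=
    (tendsto_inv_atTop_nhds_zero_nat.const_mul _).const_sub _
  have := liminf_le_liminf hle hlim.isBoundedUnder_ge
    (bdd_above_rate (meas_flow h.Φm 1) (meas_maj h.Ψm hc p A)).isCoboundedUnder_ge
  rw [hlim.liminf_eq] at this
  simpa [ent] using this

lemma main_fin [IsProbabilityMeasure μ] [IsProbabilityMeasure ν] {N : ℕ}
    (h : TC Φ Ψ μ ν σ R) {c : M → Fin N} (hc : Measurable c) {η : ℝ} (hη : 0 < η) :
    ∃ p A : ℕ, R * ent (Ψ 1) c ν ≤ ent (Φ 1) (maj Ψ c p A) μ + η := by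
  have hR := h.Rpos
  obtain ⟨ε, h0, h1, hε⟩ : ∃ ε : ℝ, 0 < ε ∧ ε < 1 ∧ R * (-Real.log (1 - ε) + -Real.log (1 - ε)) < η / 4 := by
    have hcont : ContinuousAt (fun ε : ℝ => R * (-Real.log (1 - ε) + -Real.log (1 - ε))) 0 := by
      have : ContinuousAt (fun ε : ℝ => Real.log (1 - ε)) 0 :=
        ContinuousAt.log (by fun_prop) (by norm_num)
      exact continuousAt_const.mul (this.neg.add this.neg)
    have h2 : ∀ᶠ ε in 𝓝 (0:ℝ), R * (-Real.log (1 - ε) + -Real.log (1 - ε)) < η / 4 := by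
      apply hcont.eventually (gt_mem_nhds _)
      simpa using hη
    have h3 := (h2.filter_mono nhdsWithin_le_nhds).and (Ioo_mem_nhdsGT (show (0:ℝ) < 1 by norm_num))
    obtain ⟨ε, h4, h5⟩ := h3.exists
    exact ⟨ε, h5.1, h5.2, h4⟩
  set LN := Real.log (N / ε)
  obtain ⟨p, hp, hβ1⟩ : ∃ p : ℕ, 0 < p ∧ R * (LN * (ν (Bad1 Ψ c p)).toReal) < η / 4 := by
    have h2 := ((((ENNReal.tendsto_toReal ENNReal.zero_ne_top).comp (bad1_tendsto h hc)).const_mul LN).const_mul R)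
    have h3 := h2.eventually (gt_mem_nhds (show R * (LN * (0:ℝ≥0∞).toReal) < η / 4 by simpa using hη))
    obtain ⟨p, h4, h5⟩ := ((eventually_gt_atTop 0).and h3).exists
    exact ⟨p, h4, h5⟩
  obtain ⟨a, ha, hβ3⟩ : ∃ a : ℕ, 0 < a ∧ (Real.log (1 / ε) + Real.log p) / a < η / 4 := by
    have h2 := tendsto_const_div_atTop_nhds_zero_nat (Real.log (1 / ε) + Real.log p)
    have h3 := h2.eventually (gt_mem_nhds (show 0 < η / 4 by linarith))
    obtain ⟨p, h4, h5⟩ := ((eventually_gt_atTop 0).and h3).exists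
    exact ⟨p, h4, h5⟩
  obtain ⟨A, hβ2⟩ : ∃ A : ℕ, R * (LN * (ν (Bad2 σ a A)).toReal) < η / 4 := by
    have h2 := ((((ENNReal.tendsto_toReal ENNReal.zero_ne_top).comp (bad2_tendsto h a)).const_mul LN).const_mul R)
    have h3 := h2.eventually (gt_mem_nhds (show R * (LN * (0:ℝ≥0∞).toReal) < η / 4 by simpa using hη))
    exact h3.exists
  refine ⟨p, A, ?_⟩
  have := bound_limit2 h hc h0 h1 p A a hp ha
  nlinarith

lemma metricEntropy_eq (T : M → M) (μ : Measure M) : metricEntropy T μ =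
    ⨆ c : {c : M → ℕ // Measurable c ∧ (Set.range c).Finite}, ent T c.1 μ := rfl

lemma main_nat [IsProbabilityMeasure μ] [IsProbabilityMeasure ν]
    (h : TC Φ Ψ μ ν σ R) (c : {c : M → ℕ // Measurable c ∧ (Set.range c).Finite}) {η : ℝ} (hη : 0 < η) :
    ∃ q : {c : M → ℕ // Measurable c ∧ (Set.range c).Finite},
      R * ent (Ψ 1) c.1 ν ≤ ent (Φ 1) q.1 μ + η := by
  obtain ⟨c, hc, hfin⟩ := c
  obtain ⟨N, hN⟩ := hfin.bddAbove
  have hlt : ∀ x, c x < N + 1 := fun x => Nat.lt_succ_of_le (hN ⟨x, rfl⟩)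
  set c' : M → Fin (N + 1) := fun x => ⟨c x, hlt x⟩ with hc'
  have hcm : Measurable c' := by
    apply measurable_to_countable'
    intro i
    have : c' ⁻¹' {i} = c ⁻¹' {(i:ℕ)} := by
      ext x; simp [hc', Fin.ext_iff]
    rw [this]; exact hc (measurableSet_singleton _)
  have e1 : ent (Ψ 1) c ν = ent (Ψ 1) c' ν := by
    rw [← ent_inj (Ψ 1) c' (fun i : Fin (N + 1) => (i : ℕ)) Fin.val_injective]
  obtain ⟨p, A, hpA⟩ := main_fin h hcm hη
  set g : (Fin (A * p) → Fin (N + 1) → Bool) → ℕ := fun w => (Fintype.equivFin _ w : ℕ) with hg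
  have hgi : Function.Injective g := fun w w' hw => (Fintype.equivFin _).injective (Fin.val_injective hw)
  refine ⟨⟨fun x => g (maj Ψ c' p A x), (measurable_of_finite g).comp (meas_maj h.Ψm hcm p A), ?_⟩, ?_⟩
  · exact (Set.finite_range g).subset (by rintro _ ⟨x, rfl⟩; exact ⟨_, rfl⟩)
  · simp only
    rw [ent_inj _ _ g hgi, e1]
    exact hpA

lemma sup_eq {ι κ : Type*} [Nonempty ι] [Nonempty κ] (f : ι → ℝ) (g : κ → ℝ) {R : ℝ} (hR : 0 < R)
    (h1 : ∀ i, ∀ η > 0, ∃ j, R * f i ≤ g j + η) (h2 : ∀ j, ∀ η > 0, ∃ i, R⁻¹ * g j ≤ f i + η) :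
    (⨆ i, f i) * R = ⨆ j, g j := by
  by_cases hg : BddAbove (Set.range g)
  · have hfb : ∀ i, f i ≤ R⁻¹ * ⨆ j, g j := by
      intro i
      rw [le_inv_mul_iff₀ hR]
      apply le_of_forall_pos_le_add
      intro η hη
      obtain ⟨j, hj⟩ := h1 i η hη
      linarith [le_ciSup hg j]
    have hf : BddAbove (Set.range f) := ⟨_, by rintro _ ⟨i, rfl⟩; exact hfb i⟩
    apply le_antisymm
    · have := ciSup_le hfb
      rw [le_inv_mul_iff₀ hR] at this
      linarith
    · apply ciSup_le
      intro j
      have : R⁻¹ * g j ≤ ⨆ i, f i := by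
        apply le_of_forall_pos_le_add
        intro η hη
        obtain ⟨i, hi⟩ := h2 j η hη
        linarith [le_ciSup hf i]
      rw [inv_mul_le_iff₀ hR] at this
      linarith
  · have hf : ¬ BddAbove (Set.range f) := by
      rintro ⟨B, hB⟩
      apply hg
      refine ⟨R * (B + 1), ?_⟩
      rintro _ ⟨j, rfl⟩
      obtain ⟨i, hi⟩ := h2 j 1 one_pos
      rw [← inv_mul_le_iff₀ hR]
      linarith [hB ⟨i, rfl⟩]
    rw [Real.iSup_of_not_bddAbove hf, Real.iSup_of_not_bddAbove hg, zero_mul]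

lemma abramov_abs [IsProbabilityMeasure μ] [IsProbabilityMeasure ν] {σ' : M → ℝ → ℝ}
    (h : TC Φ Ψ μ ν σ R) (h' : TC Ψ Φ ν μ σ' R⁻¹) :
    metricEntropy (Ψ 1) ν * R = metricEntropy (Φ 1) μ := by
  rw [metricEntropy_eq, metricEntropy_eq]
  have : Nonempty {c : M → ℕ // Measurable c ∧ (Set.range c).Finite} :=
    ⟨⟨fun _ => 0, measurable_const, Set.finite_range_const⟩⟩
  exact sup_eq _ _ h.Rpos (fun c η hη => main_nat h c hη) (fun c η hη => main_nat h' c hη)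

end Asymp

section Concrete
open scoped ENNReal Topology
set_option linter.unusedSectionVars false

variable {M : Type*} [MeasurableSpace M]

structure FD (φ : ℝ → M → M) (μ : Measure M) (r : M → ℝ) : Prop where
  z : φ 0 = id
  add : ∀ s t, φ (s + t) = φ s ∘ φ t
  m : Measurable fun p : ℝ × M => φ p.1 p.2
  mp : ∀ t, MeasurePreserving (φ t) μ μ
  erg : ∀ A : Set M, MeasurableSet A → (∀ t, φ t ⁻¹' A = A) → μ A = 0 ∨ μ A = 1
  rm : Measurable r
  r0 : ∀ x, 0 ≤ r x
  ri : Integrable r μ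
  rpos : 0 < ∫ x, r x ∂μ

variable {φ : ℝ → M → M} {μ : Measure M} {r : M → ℝ}

lemma FD.reverse (h : FD φ μ r) : FD (fun t => φ (-t)) μ r where
  z := by simpa using h.z
  add s t := by
    show φ (-(s + t)) = _
    rw [neg_add]; exact h.add _ _
  m := h.m.comp (measurable_fst.neg.prodMk measurable_snd)
  mp t := h.mp _
  erg A hA hinv := h.erg A hA fun t => by simpa using hinv (-t)
  rm := h.rm
  r0 := h.r0
  ri := h.ri
  rpos := h.rpos

noncomputable def lam (φ : ℝ → M → M) (r : M → ℝ) (x : M) : Measure ℝ :=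
  volume.withDensity fun s => ENNReal.ofReal (r (φ s x))

lemma FD.wm (h : FD φ μ r) : Measurable fun x => ENNReal.ofReal (r x) :=
  ENNReal.measurable_ofReal.comp h.rm

lemma FD.slice (h : FD φ μ r) (x : M) : Measurable fun s => r (φ s x) :=
  h.rm.comp (h.m.comp (measurable_id.prodMk measurable_const))

lemma FD.wslice (h : FD φ μ r) (x : M) : Measurable fun s => ENNReal.ofReal (r (φ s x)) :=
  ENNReal.measurable_ofReal.comp (h.slice x)

lemma lam_apply (x : M) {S : Set ℝ} (hS : MeasurableSet S) :
    lam φ r x S = ∫⁻ s in S, ENNReal.ofReal (r (φ s x)) := withDensity_apply _ hS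

lemma FD.shift (h : FD φ μ r) (x : M) (t : ℝ) {S : Set ℝ} (hS : MeasurableSet S) :
    lam φ r (φ t x) S = lam φ r x ((fun u => u - t) ⁻¹' S) := by
  rw [lam_apply _ hS, lam_apply (S := (fun u => u - t) ⁻¹' S) _ ((measurable_sub_const t) hS)]
  rw [← (measurePreserving_sub_right volume t).setLIntegral_comp_preimage hS (h.wslice (φ t x))]
  congr 1
  funext u
  have : φ (u - t) (φ t x) = φ u x := by
    rw [← Function.comp_apply (f := φ (u - t)), ← h.add, sub_add_cancel]
  rw [this]

lemma FD.lam_meas (h : FD φ μ r) {S : Set ℝ} (hS : MeasurableSet S) : Measurable fun x => lam φ r x S := by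
  simp only [lam_apply _ hS]
  apply Measurable.lintegral_prod_right' (f := fun p : M × ℝ => ENNReal.ofReal (r (φ p.2 p.1)))
  exact h.wm.comp (h.m.comp measurable_swap)

lemma FD.lam_int [IsProbabilityMeasure μ] (h : FD φ μ r) {S : Set ℝ} (hS : MeasurableSet S) :
    ∫⁻ x, lam φ r x S ∂μ = volume S * ENNReal.ofReal (∫ x, r x ∂μ) := by
  simp only [lam_apply _ hS]
  rw [lintegral_lintegral_swap]
  · have : ∀ s : ℝ, ∫⁻ x, ENNReal.ofReal (r (φ s x)) ∂μ = ENNReal.ofReal (∫ x, r x ∂μ) := by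
      intro s
      rw [(h.mp s).lintegral_comp h.wm, ofReal_integral_eq_lintegral_ofReal h.ri (Eventually.of_forall h.r0)]
    simp only [this]
    rw [setLIntegral_const, mul_comm]
  · exact (h.wm.comp (h.m.comp measurable_swap)).aemeasurable

def Fin1 (φ : ℝ → M → M) (r : M → ℝ) (x : M) : Prop := ∀ n : ℕ, lam φ r x (Set.Icc (-(n:ℝ)) n) < ⊤

lemma Fin1.lt_top {x : M} (hx : Fin1 φ r x) (a b : ℝ) : lam φ r x (Set.Icc a b) < ⊤ := by
  obtain ⟨n, hn⟩ := exists_nat_ge (max |a| |b|)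
  refine lt_of_le_of_lt (measure_mono ?_) (hx n)
  have ha := (le_max_left |a| |b|).trans hn
  have hb := (le_max_right |a| |b|).trans hn
  exact Set.Icc_subset_Icc (by linarith [neg_abs_le a]) ((le_abs_self b).trans hb)

lemma FD.fin1_shift (h : FD φ μ r) {x : M} (hx : Fin1 φ r x) (t : ℝ) : Fin1 φ r (φ t x) := by
  intro n
  rw [h.shift x t measurableSet_Icc]
  have : (fun u => u - t) ⁻¹' Set.Icc (-(n:ℝ)) n = Set.Icc (-n + t) (n + t) := by
    ext u; simp only [Set.mem_preimage, Set.mem_Icc]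
    constructor <;> rintro ⟨h1, h2⟩ <;> constructor <;> linarith
  rw [this]
  exact hx.lt_top _ _

lemma FD.fin1_meas (h : FD φ μ r) : MeasurableSet {x | Fin1 φ r x} := by
  have : {x | Fin1 φ r x} = ⋂ n : ℕ, {x | lam φ r x (Set.Icc (-(n:ℝ)) n) < ⊤} := by
    ext x; simp [Fin1]
  rw [this]
  exact MeasurableSet.iInter fun n => measurableSet_lt (h.lam_meas measurableSet_Icc) measurable_const

lemma FD.fin1_ae [IsProbabilityMeasure μ] (h : FD φ μ r) : ∀ᵐ x ∂μ, Fin1 φ r x := by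
  unfold Fin1
  rw [ae_all_iff]
  intro n
  apply ae_lt_top (h.lam_meas measurableSet_Icc)
  rw [h.lam_int measurableSet_Icc]
  exact ENNReal.mul_ne_top (by simp) ENNReal.ofReal_ne_top

lemma FD.fwd_shift (h : FD φ μ r) {x : M} (hx : Fin1 φ r x) (hf : lam φ r x (Set.Ioi 0) < ⊤) (t : ℝ) :
    lam φ r (φ t x) (Set.Ioi 0) < ⊤ := by
  rw [h.shift x t measurableSet_Ioi]
  refine lt_of_le_of_lt (measure_mono (t := Set.Ioi 0 ∪ Set.Icc t 0) ?_)
    ((measure_union_le _ _).trans_lt (ENNReal.add_lt_top.mpr ⟨hf, hx.lt_top _ _⟩))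
  intro u hu
  have hu' : 0 < u - t := hu
  by_cases h0 : 0 < u
  · exact Or.inl h0
  · exact Or.inr ⟨by linarith, by linarith⟩

lemma FD.back (h : FD φ μ r) (t : ℝ) (x : M) : φ (-t) (φ t x) = x := by
  rw [← Function.comp_apply (f := φ (-t)), ← h.add]; simp [h.z]

lemma FD.fwd_ae [IsProbabilityMeasure μ] (h : FD φ μ r) : ∀ᵐ x ∂μ, lam φ r x (Set.Ioi 0) = ⊤ := by
  set V : Set M := {x | Fin1 φ r x} ∩ {x | lam φ r x (Set.Ioi 0) < ⊤} with hV
  have hVm : MeasurableSet V := h.fin1_meas.inter (measurableSet_lt (h.lam_meas measurableSet_Ioi) measurable_const)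
  have hsub : ∀ t, V ⊆ φ t ⁻¹' V := fun t x hx => ⟨h.fin1_shift hx.1 t, h.fwd_shift hx.1 hx.2 t⟩
  have hVi : ∀ t, φ t ⁻¹' V = V := by
    intro t
    refine Set.Subset.antisymm ?_ (hsub t)
    intro x hx
    have := hsub (-t) hx
    rwa [Set.mem_preimage, h.back] at this
  rcases h.erg V hVm hVi with h0 | h1
  · have h2 : ∀ᵐ x ∂μ, x ∉ V := measure_eq_zero_iff_ae_notMem.mp h0
    filter_upwards [h2, h.fin1_ae] with x hx hf
    by_contra hne
    exact hx ⟨hf, lt_top_iff_ne_top.mpr hne⟩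
  · exfalso
    have hae : ∀ᵐ x ∂μ, x ∈ V := by
      rw [← prob_compl_eq_zero_iff hVm] at h1
      filter_upwards [measure_eq_zero_iff_ae_notMem.mp h1] with x hx
      simpa using hx
    set f : M → ℝ≥0∞ := fun x => lam φ r x (Set.Ioc 0 1) with hf
    have hfm : Measurable f := h.lam_meas measurableSet_Ioc
    have hzero : ∀ k : ℕ, μ {x | ENNReal.ofReal (1 / (k + 1)) < f x} = 0 := by
      intro k
      set B := {x | ENNReal.ofReal (1 / (k + 1)) < f x} with hB
      have hBm : MeasurableSet B := measurableSet_lt measurable_const hfm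
      have ht := tendsto_zero_of_ae μ (fun n : ℕ => φ n ⁻¹' B) (fun n => (h.mp n).measurable hBm) (by
        filter_upwards [hae] with x hx
        have hsum : ∑' n : ℕ, f (φ n x) ≠ ⊤ := by
          have e : ∀ n : ℕ, f (φ n x) = lam φ r x (Set.Ioc (n:ℝ) (n + 1)) := by
            intro n
            rw [hf]; simp only
            rw [h.shift x n measurableSet_Ioc]
            congr 1
            ext u; simp only [Set.mem_preimage, Set.mem_Ioc]
            constructor <;> rintro ⟨h1, h2⟩ <;> constructor <;> linarith
          simp only [e]
          rw [← measure_iUnion]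
          · refine ne_top_of_le_ne_top hx.2.ne (measure_mono ?_)
            rintro u hu
            obtain ⟨n, hn⟩ := Set.mem_iUnion.mp hu
            exact lt_of_le_of_lt (Nat.cast_nonneg n) hn.1
          · intro i j hij
            have := Set.pairwise_disjoint_Ioc_intCast ℝ (show (i:ℤ) ≠ j by exact_mod_cast hij)
            simpa [Function.onFun] using this
          · intro n; exact measurableSet_Ioc
        have := ENNReal.tendsto_atTop_zero_of_tsum_ne_top hsum
        filter_upwards [this.eventually (gt_mem_nhds (show 0 < ENNReal.ofReal (1 / (k + 1)) by
          rw [ENNReal.ofReal_pos]; positivity))] with n hn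
        simp only [hB, Set.mem_preimage, Set.mem_ofPred_eq, not_lt]
        exact hn.le)
      have hc : (fun n : ℕ => μ (φ n ⁻¹' B)) = fun _ => μ B := by
        funext n; exact (h.mp n).measure_preimage hBm.nullMeasurableSet
      rw [hc] at ht
      exact tendsto_nhds_unique tendsto_const_nhds ht
    have hfz : ∀ᵐ x ∂μ, f x = 0 := by
      have h3 : ∀ᵐ x ∂μ, ∀ k : ℕ, f x ≤ ENNReal.ofReal (1 / (k + 1)) := by
        rw [ae_all_iff]
        intro k
        filter_upwards [measure_eq_zero_iff_ae_notMem.mp (hzero k)] with x hx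
        exact not_lt.mp hx
      filter_upwards [h3] with x hx
      have : Tendsto (fun k : ℕ => ENNReal.ofReal (1 / ((k:ℝ) + 1))) atTop (𝓝 (ENNReal.ofReal 0)) :=
        ENNReal.tendsto_ofReal tendsto_one_div_add_atTop_nhds_zero_nat
      rw [ENNReal.ofReal_zero] at this
      exact le_antisymm (ge_of_tendsto' this hx) (zero_le)
    have := h.lam_int (S := Set.Ioc 0 1) measurableSet_Ioc
    rw [lintegral_congr_ae hfz] at this
    simp only [lintegral_zero, Real.volume_Ioc] at this
    have hp := h.rpos
    have h5 : (0:ℝ≥0∞) < ENNReal.ofReal (1 - 0) * ENNReal.ofReal (∫ x, r x ∂μ) :=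
      ENNReal.mul_pos (by simp) (by simpa using hp)
    rw [← this] at h5
    exact lt_irrefl _ h5

lemma FD.bwd_ae [IsProbabilityMeasure μ] (h : FD φ μ r) : ∀ᵐ x ∂μ, lam φ r x (Set.Iio 0) = ⊤ := by
  filter_upwards [h.reverse.fwd_ae] with x hx
  rw [← hx, lam_apply _ measurableSet_Ioi, lam_apply _ measurableSet_Iio,
    ← (Measure.measurePreserving_neg (volume : Measure ℝ)).setLIntegral_comp_preimage measurableSet_Iio (h.wslice x)]
  congr 2
  ext u; simp

end Concrete

section Tau
open scoped ENNReal Topology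
set_option linter.unusedSectionVars false

variable {M : Type*} [MeasurableSpace M] {φ φr : ℝ → M → M} {μ : Measure M} {r : M → ℝ}

structure GG (φ : ℝ → M → M) (r : M → ℝ) (x : M) : Prop where
  fin : Fin1 φ r x
  fwd : lam φ r x (Set.Ioi 0) = ⊤
  bwd : lam φ r x (Set.Iio 0) = ⊤

noncomputable def tau (φ : ℝ → M → M) (r : M → ℝ) (x : M) (t : ℝ) : ℝ := ∫ s in (0:ℝ)..t, r (φ s x)

lemma FD.GG_meas (h : FD φ μ r) : MeasurableSet {x | GG φ r x} := by
  have : {x | GG φ r x} = {x | Fin1 φ r x} ∩ {x | lam φ r x (Set.Ioi 0) = ⊤} ∩ {x | lam φ r x (Set.Iio 0) = ⊤} := by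
    ext x
    exact ⟨fun h => ⟨⟨h.1, h.2⟩, h.3⟩, fun h => ⟨h.1.1, h.1.2, h.2⟩⟩
  rw [this]
  exact (h.fin1_meas.inter (h.lam_meas measurableSet_Ioi (measurableSet_singleton ⊤))).inter
    (h.lam_meas measurableSet_Iio (measurableSet_singleton ⊤))

lemma FD.GG_ae [IsProbabilityMeasure μ] (h : FD φ μ r) : ∀ᵐ x ∂μ, GG φ r x := by
  filter_upwards [h.fin1_ae, h.fwd_ae, h.bwd_ae] with x h1 h2 h3 using ⟨h1, h2, h3⟩

lemma FD.GG_shift (h : FD φ μ r) {x : M} (hx : GG φ r x) (t : ℝ) : GG φ r (φ t x) := by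
  refine ⟨h.fin1_shift hx.fin t, ?_, ?_⟩
  · by_contra hne
    have := h.fwd_shift (h.fin1_shift hx.fin t) (lt_top_iff_ne_top.mpr hne) (-t)
    rw [h.back, hx.fwd] at this
    exact lt_irrefl _ this
  · rw [h.shift x t measurableSet_Iio]
    by_contra hne
    have : lam φ r x (Set.Iio 0) < ⊤ := by
      refine lt_of_le_of_lt (measure_mono (t := ((fun u => u - t) ⁻¹' Set.Iio 0) ∪ Set.Icc t 0) ?_)
        ((measure_union_le _ _).trans_lt
          (ENNReal.add_lt_top.mpr ⟨lt_top_iff_ne_top.mpr hne, hx.fin.lt_top _ _⟩))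
      intro u hu
      have hu' : u < 0 := hu
      by_cases h0 : u < t
      · exact Or.inl (show u - t < 0 by linarith)
      · exact Or.inr ⟨by linarith, by linarith⟩
    rw [hx.bwd] at this
    exact lt_irrefl _ this

lemma FD.intOn (h : FD φ μ r) {x : M} (hx : Fin1 φ r x) (a b : ℝ) :
    IntegrableOn (fun s => r (φ s x)) (Set.Icc a b) := by
  refine ⟨(h.slice x).aestronglyMeasurable, ?_⟩
  rw [hasFiniteIntegral_iff_ofReal (Eventually.of_forall fun s => h.r0 _)]
  have := hx.lt_top a b
  rwa [lam_apply _ measurableSet_Icc] at this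

lemma FD.intv (h : FD φ μ r) {x : M} (hx : Fin1 φ r x) (a b : ℝ) :
    IntervalIntegrable (fun s => r (φ s x)) volume a b := by
  rw [intervalIntegrable_iff']
  exact h.intOn hx _ _

lemma FD.tau_cont (h : FD φ μ r) {x : M} (hx : Fin1 φ r x) : Continuous (tau φ r x) :=
  intervalIntegral.continuous_primitive (fun a b => h.intv hx a b) 0

lemma FD.tau_sub (h : FD φ μ r) {x : M} (hx : Fin1 φ r x) (a b : ℝ) :
    tau φ r x b - tau φ r x a = ∫ s in a..b, r (φ s x) :=
  intervalIntegral.integral_interval_sub_left (h.intv hx _ _) (h.intv hx _ _)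

lemma FD.tau_lam (h : FD φ μ r) {x : M} (hx : Fin1 φ r x) {a b : ℝ} (hab : a ≤ b) :
    lam φ r x (Set.Ioc a b) = ENNReal.ofReal (tau φ r x b - tau φ r x a) := by
  rw [h.tau_sub hx, intervalIntegral.integral_of_le hab, lam_apply _ measurableSet_Ioc,
    ofReal_integral_eq_lintegral_ofReal _ (Eventually.of_forall fun s => h.r0 _)]
  exact (h.intOn hx a b).mono_set Set.Ioc_subset_Icc_self

lemma FD.tau_mono (h : FD φ μ r) {x : M} (hx : Fin1 φ r x) : Monotone (tau φ r x) := by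
  intro a b hab
  have := h.tau_sub hx a b
  have h2 : 0 ≤ ∫ s in a..b, r (φ s x) := intervalIntegral.integral_nonneg hab fun u _ => h.r0 _
  linarith

lemma tau_zero (x : M) : tau φ r x 0 = 0 := by simp [tau]

lemma FD.tau_coc (h : FD φ μ r) {x : M} (hx : Fin1 φ r x) (t s : ℝ) :
    tau φ r x (t + s) = tau φ r x t + tau φ r (φ t x) s := by
  have h1 := h.tau_sub hx t (t + s)
  have h2 : tau φ r (φ t x) s = ∫ u in t..(t+s), r (φ u x) := by
    unfold tau
    have e : ∀ u, r (φ u (φ t x)) = (fun v => r (φ v x)) (u + t) := by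
      intro u
      simp only
      rw [h.add]; rfl
    simp only [e]
    rw [intervalIntegral.integral_comp_add_right (fun v => r (φ v x)) t, zero_add, add_comm s t]
  linarith

lemma FD.tau_strict (h : FD φ μ r) (hrep : ∀ x t, φr (tau φ r x t) x = φ t x) {x : M} (hx : GG φ r x) :
    StrictMono (tau φ r x) := by
  refine (h.tau_mono hx.fin).strictMono_of_injective ?_
  have key : ∀ a b, a < b → tau φ r x a ≠ tau φ r x b := by
    intro a b hab heq
    set z := φ a x with hz
    have hzG := h.GG_shift hx a
    have hfix : φ (b - a) z = z := by
      rw [hz, ← Function.comp_apply (f := φ (b - a)), ← h.add, sub_add_cancel, ← hrep x b, ← heq, hrep]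
    set d := b - a with hd
    have hdp : 0 < d := by linarith
    have hz0 : lam φ r z (Set.Ioc 0 d) = 0 := by
      rw [h.tau_lam hzG.fin hdp.le, tau_zero]
      have := h.tau_coc hx.fin a d
      rw [hd, add_sub_cancel, ← heq] at this
      have h3 : tau φ r z d = 0 := by
        rw [hd]
        linarith
      rw [← hz, h3]
      simp
    have hn : ∀ n : ℕ, φ (n * d) z = z := by
      intro n
      induction n with
      | zero => simp [h.z]
      | succ n ih =>
        push_cast
        rw [add_mul, one_mul, h.add, Function.comp_apply, hfix, ih]
    have hn0 : ∀ n : ℕ, lam φ r z (Set.Ioc (n * d) (n * d + d)) = 0 := by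
      intro n
      rw [← hz0]
      conv_rhs => rw [← hn n]
      rw [h.shift z _ measurableSet_Ioc]
      congr 1
      ext u; simp only [Set.mem_preimage, Set.mem_Ioc]
      constructor <;> rintro ⟨h1, h2⟩ <;> constructor <;> linarith
    have hU : Set.Ioi (0:ℝ) ⊆ ⋃ n : ℕ, Set.Ioc (n * d) (n * d + d) := by
      intro u hu
      have hu' : (0:ℝ) < u := hu
      have hpos : 0 < u / d := div_pos hu' hdp
      have hc : 0 < ⌈u / d⌉₊ := Nat.ceil_pos.mpr hpos
      refine Set.mem_iUnion.mpr ⟨⌈u / d⌉₊ - 1, ?_, ?_⟩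
      · rw [Nat.cast_sub hc, Nat.cast_one]
        have := Nat.ceil_lt_add_one hpos.le
        rw [← lt_div_iff₀ hdp]; linarith
      · rw [Nat.cast_sub hc, Nat.cast_one]
        have := Nat.le_ceil (u / d)
        rw [div_le_iff₀ hdp] at this
        linarith
    have : lam φ r z (Set.Ioi 0) = 0 := measure_mono_null hU (measure_iUnion_null hn0)
    rw [hzG.fwd] at this
    exact ENNReal.top_ne_zero this
  intro a b hab
  rcases lt_trichotomy a b with h1 | h1 | h1
  · exact absurd hab (key a b h1)
  · exact h1
  · exact absurd hab.symm (key b a h1)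

lemma FD.tau_surj (h : FD φ μ r) {x : M} (hx : GG φ r x) : Function.Surjective (tau φ r x) := by
  intro s
  have hup : ∃ t, s ≤ tau φ r x t := by
    by_contra hcon
    push Not at hcon
    have hle : lam φ r x (Set.Ioi 0) ≤ ENNReal.ofReal s := by
      have hU : Set.Ioi (0:ℝ) ⊆ ⋃ n : ℕ, Set.Ioc (0:ℝ) n := by
        intro u hu
        obtain ⟨n, hn⟩ := exists_nat_ge u
        exact Set.mem_iUnion.mpr ⟨n, hu, hn⟩
      refine (measure_mono hU).trans ?_
      rw [Monotone.measure_iUnion]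
      · refine iSup_le fun n => ?_
        rw [h.tau_lam hx.fin (Nat.cast_nonneg n), tau_zero, sub_zero]
        exact ENNReal.ofReal_le_ofReal (hcon n).le
      · intro m n hmn
        exact Set.Ioc_subset_Ioc_right (by exact_mod_cast hmn)
    rw [hx.fwd] at hle
    exact absurd hle (by simp)
  have hdn : ∃ t, tau φ r x t ≤ s := by
    by_contra hcon
    push Not at hcon
    have hle : lam φ r x (Set.Iio 0) ≤ ENNReal.ofReal (-s) := by
      have hU : Set.Iio (0:ℝ) ⊆ ⋃ n : ℕ, Set.Ioc (-(n:ℝ)) 0 := by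
        intro u hu
        obtain ⟨n, hn⟩ := exists_nat_gt (-u)
        exact Set.mem_iUnion.mpr ⟨n, by linarith, (show u < 0 from hu).le⟩
      refine (measure_mono hU).trans ?_
      rw [Monotone.measure_iUnion]
      · refine iSup_le fun n => ?_
        rw [h.tau_lam hx.fin (by simp), tau_zero, zero_sub]
        apply ENNReal.ofReal_le_ofReal
        linarith [hcon (-(n:ℝ))]
      · intro m n hmn
        apply Set.Ioc_subset_Ioc_left
        have : (m:ℝ) ≤ n := by exact_mod_cast hmn
        linarith
    rw [hx.bwd] at hle
    exact absurd hle (by simp)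
  obtain ⟨a, ha⟩ := hdn
  obtain ⟨b, hb⟩ := hup
  exact mem_range_of_exists_le_of_exists_ge (h.tau_cont hx.fin) ⟨a, ha⟩ ⟨b, hb⟩

lemma FD.map_lam (h : FD φ μ r) (hrep : ∀ x t, φr (tau φ r x t) x = φ t x) {x : M} (hx : GG φ r x) :
    Measure.map (tau φ r x) (lam φ r x) = volume := by
  have hm := (h.tau_cont hx.fin).measurable
  have hst := h.tau_strict hrep hx
  have key : ∀ a b : ℝ, Measure.map (tau φ r x) (lam φ r x) (Set.Ioo a b) = volume (Set.Ioo a b) := by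
    intro a b
    rw [Measure.map_apply hm measurableSet_Ioo, Real.volume_Ioo]
    obtain ⟨a', rfl⟩ := h.tau_surj hx a
    obtain ⟨b', rfl⟩ := h.tau_surj hx b
    have e : tau φ r x ⁻¹' Set.Ioo (tau φ r x a') (tau φ r x b') = Set.Ioo a' b' := by
      ext u; simp [hst.lt_iff_lt]
    rw [e]
    have hac : lam φ r x ≪ volume := withDensity_absolutelyContinuous _ _
    rcases le_total a' b' with hab | hab
    · rw [← h.tau_lam hx.fin hab]
      exact measure_congr (hac.ae_eq Ioo_ae_eq_Ioc)
    · rw [Set.Ioo_eq_empty (not_lt.mpr hab), measure_empty]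
      have := h.tau_mono hx.fin hab
      rw [ENNReal.ofReal_of_nonpos (by linarith)]
  have : IsLocallyFiniteMeasure (Measure.map (tau φ r x) (lam φ r x)) := by
    refine ⟨fun u => ⟨Set.Ioo (u - 1) (u + 1), Ioo_mem_nhds (by linarith) (by linarith), ?_⟩⟩
    rw [key]; simp
  exact Real.measure_ext_Ioo_rat fun a b => key a b

lemma FD.cv (h : FD φ μ r) (hrep : ∀ x t, φr (tau φ r x t) x = φ t x) {x : M} (hx : GG φ r x)
    {H : ℝ → ℝ≥0∞} (hH : Measurable H) :
    ∫⁻ s, H s = ∫⁻ u, ENNReal.ofReal (r (φ u x)) * H (tau φ r x u) := by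
  have hm := (h.tau_cont hx.fin).measurable
  conv_lhs => rw [← h.map_lam hrep hx]
  rw [lintegral_map hH hm, lam]
  exact lintegral_withDensity_eq_lintegral_mul _ (h.wslice x) (hH.comp hm)

lemma FD.tau_meas (h : FD φ μ r) : Measurable fun p : M × ℝ => tau φ r p.1 p.2 := by
  have hf : Measurable fun q : (M × ℝ) × ℝ => r (φ q.2 q.1.1) :=
    h.rm.comp (h.m.comp (measurable_snd.prodMk (measurable_fst.comp measurable_fst)))
  have e : (fun p : M × ℝ => tau φ r p.1 p.2) = fun p : M × ℝ =>
      (∫ s, ({q : (M × ℝ) × ℝ | 0 < q.2 ∧ q.2 ≤ q.1.2}).indicator (fun q => r (φ q.2 q.1.1)) (p, s)) -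
      ∫ s, ({q : (M × ℝ) × ℝ | q.1.2 < q.2 ∧ q.2 ≤ 0}).indicator (fun q => r (φ q.2 q.1.1)) (p, s) := by
    funext p
    rw [tau, intervalIntegral, ← MeasureTheory.integral_indicator measurableSet_Ioc, ← MeasureTheory.integral_indicator measurableSet_Ioc]
    rfl
  rw [e]
  have m1 : MeasurableSet {q : (M × ℝ) × ℝ | 0 < q.2 ∧ q.2 ≤ q.1.2} :=
    (measurableSet_lt measurable_const measurable_snd).inter
      (measurableSet_le measurable_snd (measurable_snd.comp measurable_fst))
  have m2 : MeasurableSet {q : (M × ℝ) × ℝ | q.1.2 < q.2 ∧ q.2 ≤ 0} :=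
    (measurableSet_lt (measurable_snd.comp measurable_fst) measurable_snd).inter
      (measurableSet_le measurable_snd measurable_const)
  exact (hf.indicator m1).stronglyMeasurable.integral_prod_right'.measurable.sub
    (hf.indicator m2).stronglyMeasurable.integral_prod_right'.measurable

end Tau

section Final
open scoped ENNReal Topology
set_option linter.unusedSectionVars false

variable {M : Type*} [MeasurableSpace M] {φ φr : ℝ → M → M} {μ : Measure M} {r : M → ℝ}

noncomputable def mur (μ : Measure M) (r : M → ℝ) : Measure M :=
  (ENNReal.ofReal (∫ x, r x ∂μ))⁻¹ • μ.withDensity fun x => ENNReal.ofReal (r x)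

lemma FD.lint_mur (h : FD φ μ r) {F : M → ℝ≥0∞} (hF : Measurable F) :
    ∫⁻ x, F x ∂(mur μ r) = (ENNReal.ofReal (∫ x, r x ∂μ))⁻¹ * ∫⁻ x, ENNReal.ofReal (r x) * F x ∂μ := by
  rw [mur, lintegral_smul_measure, lintegral_withDensity_eq_lintegral_mul _ h.wm hF]
  rfl

lemma FD.R_ne (h : FD φ μ r) : ENNReal.ofReal (∫ x, r x ∂μ) ≠ 0 := (ENNReal.ofReal_pos.mpr h.rpos).ne'

lemma FD.R_eq (h : FD φ μ r) : ∫⁻ x, ENNReal.ofReal (r x) ∂μ = ENNReal.ofReal (∫ x, r x ∂μ) :=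
  (ofReal_integral_eq_lintegral_ofReal h.ri (Eventually.of_forall h.r0)).symm

lemma FD.mur_prob (h : FD φ μ r) : IsProbabilityMeasure (mur μ r) := by
  constructor
  rw [← lintegral_one, h.lint_mur measurable_const]
  simp only [mul_one]
  rw [h.R_eq, ENNReal.inv_mul_cancel h.R_ne ENNReal.ofReal_ne_top]

lemma FD.mur_ac : mur μ r ≪ μ :=
  (Measure.smul_absolutelyContinuous).trans (withDensity_absolutelyContinuous _ _)

lemma FD.form1 [IsProbabilityMeasure μ] (h : FD φ μ r) (hm : Measurable fun p : ℝ × M => φr p.1 p.2)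
    (hrep : ∀ x t, φr (tau φ r x t) x = φ t x)
    {F : M → ℝ≥0∞} (hF : Measurable F) {t : ℝ} (ht : 0 ≤ t) :
    ∫⁻ x, (∫⁻ s in {s : ℝ | 0 < s ∧ s < tau φ r x t}, F (φr s x)) ∂μ =
      ENNReal.ofReal (t * ∫ x, r x ∂μ) * ∫⁻ x, F x ∂(mur μ r) := by
  have h1 : ∀ᵐ x ∂μ, (∫⁻ s in {s : ℝ | 0 < s ∧ s < tau φ r x t}, F (φr s x)) =
      ∫⁻ u in Set.Ioo 0 t, ENNReal.ofReal (r (φ u x)) * F (φ u x) := by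
    filter_upwards [h.GG_ae] with x hx
    have hst := h.tau_strict hrep hx
    have hs : MeasurableSet {s : ℝ | 0 < s ∧ s < tau φ r x t} := measurableSet_Ioo
    have hH : Measurable (({s : ℝ | 0 < s ∧ s < tau φ r x t}).indicator fun s => F (φr s x)) :=
      (hF.comp (hm.comp (measurable_id.prodMk measurable_const))).indicator hs
    rw [← lintegral_indicator hs, h.cv hrep hx hH, ← lintegral_indicator measurableSet_Ioo]
    congr 1
    funext u
    have hiff : tau φ r x u ∈ {s : ℝ | 0 < s ∧ s < tau φ r x t} ↔ u ∈ Set.Ioo 0 t := by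
      rw [Set.mem_ofPred_eq, hst.lt_iff_lt, Set.mem_Ioo]
      conv_lhs => rw [← tau_zero (φ := φ) (r := r) x, hst.lt_iff_lt]
    by_cases hu : u ∈ Set.Ioo 0 t
    · rw [Set.indicator_of_mem hu, Set.indicator_of_mem (hiff.mpr hu), hrep]
    · rw [Set.indicator_of_notMem hu, Set.indicator_of_notMem (fun hh => hu (hiff.mp hh)), mul_zero]
  rw [lintegral_congr_ae h1]
  have hwF : Measurable fun x => ENNReal.ofReal (r x) * F x := h.wm.mul hF
  have hu : Measurable (Function.uncurry fun (x : M) (u : ℝ) => ENNReal.ofReal (r (φ u x)) * F (φ u x)) :=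
    hwF.comp (h.m.comp measurable_swap)
  rw [lintegral_lintegral_swap hu.aemeasurable]
  have : ∀ u : ℝ, ∫⁻ x, ENNReal.ofReal (r (φ u x)) * F (φ u x) ∂μ = ∫⁻ x, ENNReal.ofReal (r x) * F x ∂μ :=
    fun u => (h.mp u).lintegral_comp hwF
  simp only [this]
  rw [setLIntegral_const, Real.volume_Ioo, sub_zero, h.lint_mur hF, ENNReal.ofReal_mul ht, ← mul_assoc,
    mul_assoc (ENNReal.ofReal t), ENNReal.mul_inv_cancel h.R_ne ENNReal.ofReal_ne_top, mul_one, mul_comm]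

open Classical in
noncomputable def sig (φ : ℝ → M → M) (r : M → ℝ) (y : M) (s : ℝ) : ℝ :=
  if h : ∃ t, GG φ r y ∧ tau φ r y t = s then h.choose else s

lemma FD.tau_sig (h : FD φ μ r) {y : M} (hy : GG φ r y) (s : ℝ) : tau φ r y (sig φ r y s) = s := by
  obtain ⟨t, ht⟩ := h.tau_surj hy s
  have hex : ∃ t, GG φ r y ∧ tau φ r y t = s := ⟨t, hy, ht⟩
  rw [sig, dif_pos hex]
  exact hex.choose_spec.2

lemma sig_not {y : M} (hy : ¬ GG φ r y) (s : ℝ) : sig φ r y s = s := by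
  rw [sig, dif_neg]
  rintro ⟨t, h1, _⟩
  exact hy h1

lemma FD.lt_sig (h : FD φ μ r) (hrep : ∀ x t, φr (tau φ r x t) x = φ t x) {y : M} (hy : GG φ r y) (t s : ℝ) :
    t < sig φ r y s ↔ tau φ r y t < s := by
  conv_rhs => rw [← h.tau_sig hy s]
  exact ((h.tau_strict hrep hy).lt_iff_lt).symm

lemma FD.form2 [IsProbabilityMeasure μ] (h : FD φ μ r)
    (hrep : ∀ x t, φr (tau φ r x t) x = φ t x)
    {F : M → ℝ≥0∞} (hF : Measurable F) {s : ℝ} (hs : 0 ≤ s) :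
    ∫⁻ y, (∫⁻ t in {t : ℝ | 0 < t ∧ t < sig φ r y s}, F (φ t y)) ∂(mur μ r) =
      ENNReal.ofReal (s / ∫ x, r x ∂μ) * ∫⁻ x, F x ∂μ := by
  set K : M → ℝ → ℝ≥0∞ := fun y t => ({q : M × ℝ | tau φ r q.1 q.2 < s}).indicator (fun q => F (φ q.2 q.1)) (y, t) with hK
  have hKm : Measurable (Function.uncurry K) :=
    (hF.comp (h.m.comp measurable_swap)).indicator (measurableSet_lt h.tau_meas measurable_const)
  have h1 : ∀ᵐ y ∂(mur μ r), (∫⁻ t in {t : ℝ | 0 < t ∧ t < sig φ r y s}, F (φ t y)) =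
      ∫⁻ t in Set.Ioi 0, K y t := by
    filter_upwards [FD.mur_ac.ae_le h.GG_ae] with y hy
    have hms : MeasurableSet {t : ℝ | 0 < t ∧ t < sig φ r y s} := measurableSet_Ioo
    rw [← lintegral_indicator hms, ← lintegral_indicator measurableSet_Ioi]
    congr 1
    funext t
    by_cases h0 : 0 < t
    · rw [Set.indicator_of_mem (s := Set.Ioi 0) h0]
      by_cases h2 : tau φ r y t < s
      · have : t ∈ {t : ℝ | 0 < t ∧ t < sig φ r y s} := ⟨h0, (h.lt_sig hrep hy t s).mpr h2⟩
        rw [Set.indicator_of_mem this, hK]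
        simp only
        rw [Set.indicator_of_mem]
        exact h2
      · have : t ∉ {t : ℝ | 0 < t ∧ t < sig φ r y s} := fun hh => h2 ((h.lt_sig hrep hy t s).mp hh.2)
        rw [Set.indicator_of_notMem this, hK]
        simp only
        rw [Set.indicator_of_notMem]
        exact h2
    · rw [Set.indicator_of_notMem (s := Set.Ioi 0) h0, Set.indicator_of_notMem]
      exact fun hh => h0 hh.1
  have hKi : Measurable fun y => ∫⁻ t in Set.Ioi 0, K y t := hKm.lintegral_prod_right'
  rw [lintegral_congr_ae h1, h.lint_mur hKi]
  have h2 : ∀ y, ENNReal.ofReal (r y) * ∫⁻ t in Set.Ioi 0, K y t = ∫⁻ t in Set.Ioi 0, ENNReal.ofReal (r y) * K y t :=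
    fun y => (lintegral_const_mul _ (hKm.comp (measurable_const.prodMk measurable_id))).symm
  simp only [h2]
  have hwK : Measurable (Function.uncurry fun y t => ENNReal.ofReal (r y) * K y t) :=
    (h.wm.comp measurable_fst).mul hKm
  rw [lintegral_lintegral_swap hwK.aemeasurable]
  have h3 : ∀ t : ℝ, ∫⁻ y, ENNReal.ofReal (r y) * K y t ∂μ =
      ∫⁻ x, ENNReal.ofReal (r (φ (-t) x)) * K (φ (-t) x) t ∂μ := fun t =>
    ((h.mp (-t)).lintegral_comp (hwK.comp (measurable_id.prodMk measurable_const))).symm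
  simp only [h3]
  have hw2 : Measurable (Function.uncurry fun (t : ℝ) x => ENNReal.ofReal (r (φ (-t) x)) * K (φ (-t) x) t) :=
    hwK.comp ((h.m.comp (measurable_fst.neg.prodMk measurable_snd)).prodMk measurable_fst)
  rw [lintegral_lintegral_swap hw2.aemeasurable]
  have h4 : ∀ᵐ x ∂μ, (∫⁻ t in Set.Ioi 0, ENNReal.ofReal (r (φ (-t) x)) * K (φ (-t) x) t) =
      ENNReal.ofReal s * F x := by
    filter_upwards [h.GG_ae] with x hx
    have hst := h.tau_strict hrep hx
    have hcv := h.cv hrep hx (H := (Set.Ioo (-s) 0).indicator fun _ => F x)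
      (measurable_const.indicator measurableSet_Ioo)
    rw [lintegral_indicator measurableSet_Ioo, setLIntegral_const, Real.volume_Ioo] at hcv
    rw [show (0:ℝ) - -s = s by ring, mul_comm, ← lintegral_neg_eq_self] at hcv
    rw [hcv, ← lintegral_indicator measurableSet_Ioi]
    congr 1
    funext t
    have hneg : tau φ r (φ (-t) x) t = - tau φ r x (-t) := by
      have := h.tau_coc hx.fin (-t) t
      rw [neg_add_cancel, tau_zero] at this
      linarith
    have hback : φ t (φ (-t) x) = x := by simpa using h.back (-t) x
    have hz : 0 < t ↔ tau φ r x (-t) < 0 := by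
      conv_rhs => rw [← tau_zero (φ := φ) (r := r) x, hst.lt_iff_lt]
      simp
    by_cases ht : 0 < t
    · rw [Set.indicator_of_mem (s := Set.Ioi 0) ht, hK]
      simp only
      by_cases h5 : -s < tau φ r x (-t)
      · rw [Set.indicator_of_mem (s := Set.Ioo (-s) 0) ⟨h5, hz.mp ht⟩, Set.indicator_of_mem]
        · rw [hback]
        · show tau φ r (φ (-t) x) t < s
          rw [hneg]; linarith
      · rw [Set.indicator_of_notMem (s := Set.Ioo (-s) 0) (fun hh => h5 hh.1), Set.indicator_of_notMem]
        show ¬ tau φ r (φ (-t) x) t < s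
        rw [hneg]; intro hh; apply h5; linarith
    · rw [Set.indicator_of_notMem (s := Set.Ioi 0) ht,
        Set.indicator_of_notMem (s := Set.Ioo (-s) 0) (fun hh => ht (hz.mpr hh.2)), mul_zero]
  rw [lintegral_congr_ae h4, lintegral_const_mul _ hF, ← mul_assoc, ENNReal.ofReal_div_of_pos h.rpos,
    ENNReal.div_eq_inv_mul]

lemma FD.mur_le [IsProbabilityMeasure μ] (h : FD φ μ r) (hm : Measurable fun p : ℝ × M => φr p.1 p.2)
    (hadd : ∀ s t, φr (s + t) = φr s ∘ φr t)
    (hrep : ∀ x t, φr (tau φ r x t) x = φ t x) {E : Set M} (hE : MeasurableSet E) (s : ℝ) :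
    mur μ r (φr s ⁻¹' E) ≤ mur μ r E := by
  have := h.mur_prob
  have hE' : MeasurableSet (φr s ⁻¹' E) := meas_flow hm s hE
  have hR := h.rpos
  set R := ∫ x, r x ∂μ with hRdef
  have key : ∀ t : ℝ, 0 ≤ t → ENNReal.ofReal (t * R) * mur μ r (φr s ⁻¹' E) ≤
      ENNReal.ofReal (t * R) * mur μ r E + ENNReal.ofReal (2 * |s|) := by
    intro t ht
    rw [← lintegral_indicator_one hE', ← lintegral_indicator_one hE]
    rw [← h.form1 hm hrep (measurable_one.indicator hE') ht, ← h.form1 hm hrep (measurable_one.indicator hE) ht]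
    have hc : ENNReal.ofReal (2 * |s|) = ∫⁻ _ : M, ENNReal.ofReal (2 * |s|) ∂μ := by simp
    rw [hc, ← lintegral_add_right _ measurable_const]
    apply lintegral_mono
    intro x
    simp only
    set A : Set ℝ := {u | φr u x ∈ E} with hA
    have hAm : MeasurableSet A := (hm.comp (measurable_id.prodMk measurable_const)) hE
    set T := tau φ r x t
    have hset : MeasurableSet {s : ℝ | 0 < s ∧ s < T} := measurableSet_Ioo
    have e1 : ∫⁻ u in {s : ℝ | 0 < s ∧ s < T}, (φr s ⁻¹' E).indicator (1 : M → ℝ≥0∞) (φr u x) =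
        volume (((fun u => s + u) ⁻¹' A) ∩ {s : ℝ | 0 < s ∧ s < T}) := by
      have : (fun u => (φr s ⁻¹' E).indicator (1 : M → ℝ≥0∞) (φr u x)) = ((fun u => s + u) ⁻¹' A).indicator 1 := by
        funext u
        have hiff : u ∈ (fun u => s + u) ⁻¹' A ↔ φr u x ∈ φr s ⁻¹' E := by
          show φr (s + u) x ∈ E ↔ φr s (φr u x) ∈ E
          rw [hadd]; rfl
        by_cases hu : u ∈ (fun u => s + u) ⁻¹' A
        · rw [Set.indicator_of_mem hu, Set.indicator_of_mem (hiff.mp hu)]; rfl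
        · rw [Set.indicator_of_notMem hu, Set.indicator_of_notMem (fun hh => hu (hiff.mpr hh))]
      rw [this, lintegral_indicator_one ((measurable_const_add s) hAm),
        Measure.restrict_apply ((measurable_const_add s) hAm)]
    have e2 : ∫⁻ u in {s : ℝ | 0 < s ∧ s < T}, E.indicator (1 : M → ℝ≥0∞) (φr u x) =
        volume (A ∩ {s : ℝ | 0 < s ∧ s < T}) := by
      have : (fun u => E.indicator (1 : M → ℝ≥0∞) (φr u x)) = A.indicator 1 := rfl
      rw [this, lintegral_indicator_one hAm, Measure.restrict_apply hAm]
    rw [e1, e2]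
    have e3 : ((fun u => s + u) ⁻¹' A) ∩ {s : ℝ | 0 < s ∧ s < T} =
        (fun u => s + u) ⁻¹' (A ∩ Set.Ioo s (s + T)) := by
      ext u
      simp only [Set.mem_inter_iff, Set.mem_preimage, Set.mem_ofPred_eq, Set.mem_Ioo]
      constructor
      · rintro ⟨h1, h2, h3⟩; exact ⟨h1, by linarith, by linarith⟩
      · rintro ⟨h1, h2, h3⟩; exact ⟨h1, by linarith, by linarith⟩
    rw [e3, measure_preimage_add]
    have hsub : A ∩ Set.Ioo s (s + T) ⊆ (A ∩ {s : ℝ | 0 < s ∧ s < T}) ∪ (Set.Icc (-|s|) 0 ∪ Set.Icc T (T + |s|)) := by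
      rintro u ⟨hu, h1, h2⟩
      by_cases h3 : 0 < u
      · by_cases h4 : u < T
        · exact Or.inl ⟨hu, h3, h4⟩
        · exact Or.inr (Or.inr ⟨by linarith, by linarith [le_abs_self s]⟩)
      · exact Or.inr (Or.inl ⟨by linarith [neg_abs_le s], by linarith⟩)
    refine (measure_mono hsub).trans ((measure_union_le _ _).trans ?_)
    refine add_le_add le_rfl ((measure_union_le _ _).trans (le_of_eq ?_))
    rw [Real.volume_Icc, Real.volume_Icc, ← ENNReal.ofReal_add (by simp) (by simp)]
    congr 1; ring
  -- pass to the limit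
  have hfin : ∀ B, mur μ r B ≠ ⊤ := fun B => measure_ne_top _ B
  have hreal : ∀ t : ℝ, 0 ≤ t → t * R * (mur μ r (φr s ⁻¹' E)).toReal ≤ t * R * (mur μ r E).toReal + 2 * |s| := by
    intro t ht
    have h1 := key t ht
    rw [← ENNReal.ofReal_toReal (hfin (φr s ⁻¹' E)), ← ENNReal.ofReal_toReal (hfin E),
      ← ENNReal.ofReal_mul (by positivity), ← ENNReal.ofReal_mul (by positivity),
      ← ENNReal.ofReal_add (by positivity) (by positivity)] at h1
    exact (ENNReal.ofReal_le_ofReal_iff (by positivity)).mp h1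
  rw [← ENNReal.toReal_le_toReal (hfin _) (hfin _)]
  by_contra hcon
  push Not at hcon
  set d := (mur μ r (φr s ⁻¹' E)).toReal - (mur μ r E).toReal with hd
  have hdp : 0 < d := by linarith
  have h2 := hreal ((2 * |s| + 1) / (R * d)) (by positivity)
  have h3 : (2 * |s| + 1) / (R * d) * R * d = 2 * |s| + 1 := by field_simp
  have h4 : (mur μ r (φr s ⁻¹' E)).toReal = (mur μ r E).toReal + d := by rw [hd]; ring
  rw [h4, mul_add, h3] at h2
  linarith

lemma FD.mur_inv [IsProbabilityMeasure μ] (h : FD φ μ r) (hm : Measurable fun p : ℝ × M => φr p.1 p.2)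
    (hz : φr 0 = id) (hadd : ∀ s t, φr (s + t) = φr s ∘ φr t)
    (hrep : ∀ x t, φr (tau φ r x t) x = φ t x) (s : ℝ) : MeasurePreserving (φr s) (mur μ r) (mur μ r) := by
  refine ⟨meas_flow hm s, ?_⟩
  ext E hE
  rw [Measure.map_apply (meas_flow hm s) hE]
  apply le_antisymm (h.mur_le hm hadd hrep hE s)
  have := h.mur_le hm hadd hrep (meas_flow hm s hE) (-s)
  rwa [← Set.preimage_comp, ← hadd, add_neg_cancel, hz, Set.preimage_id] at this

lemma FD.tcB [IsProbabilityMeasure μ] (h : FD φ μ r) (hm : Measurable fun p : ℝ × M => φr p.1 p.2)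
    (hz : φr 0 = id) (hadd : ∀ s t, φr (s + t) = φr s ∘ φr t)
    (hrep : ∀ x t, φr (tau φ r x t) x = φ t x) :
    TC φr φ (mur μ r) μ (tau φ r) (∫ x, r x ∂μ)⁻¹ where
  Φ0 := hz
  Φadd := hadd
  Φm := hm
  Ψ0 := h.z
  Ψadd := h.add
  Ψm := h.m
  Ψinv := h.mp
  Rpos := inv_pos.mpr h.rpos
  good := by
    filter_upwards [h.GG_ae] with y hy
    exact ⟨h.tau_strict hrep hy, h.tau_surj hy, tau_zero y, h.tau_coc hy.fin, hrep y⟩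
  meas s := measurableSet_lt measurable_snd (h.tau_meas.comp (measurable_fst.prodMk measurable_const))
  formula F hF m := by
    rw [h.form1 hm hrep hF (Nat.cast_nonneg m), div_inv_eq_mul]

lemma FD.tcA [IsProbabilityMeasure μ] (h : FD φ μ r) (hm : Measurable fun p : ℝ × M => φr p.1 p.2)
    (hz : φr 0 = id) (hadd : ∀ s t, φr (s + t) = φr s ∘ φr t)
    (hrep : ∀ x t, φr (tau φ r x t) x = φ t x) :
    TC φ φr μ (mur μ r) (sig φ r) (∫ x, r x ∂μ) where
  Φ0 := h.z
  Φadd := h.add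
  Φm := h.m
  Ψ0 := hz
  Ψadd := hadd
  Ψm := hm
  Ψinv := h.mur_inv hm hz hadd hrep
  Rpos := h.rpos
  good := by
    filter_upwards [FD.mur_ac.ae_le h.GG_ae] with y hy
    have hst := h.tau_strict hrep hy
    have horb : ∀ s, φ (sig φ r y s) y = φr s y := fun s => by
      rw [← hrep, h.tau_sig hy]
    refine ⟨?_, ?_, ?_, ?_, horb⟩
    · intro a b hab
      rw [h.lt_sig hrep hy, h.tau_sig hy]; exact hab
    · intro t
      exact ⟨tau φ r y t, hst.injective (h.tau_sig hy _)⟩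
    · apply hst.injective
      rw [h.tau_sig hy, tau_zero]
    · intro s u
      apply hst.injective
      have hG : GG φ r (φr s y) := by rw [← horb s]; exact h.GG_shift hy _
      rw [h.tau_coc hy.fin, h.tau_sig hy, h.tau_sig hy, horb, h.tau_sig hG]
  meas s := by
    have : {p : M × ℝ | p.2 < sig φ r p.1 s} =
        ({p : M × ℝ | GG φ r p.1} ∩ {p : M × ℝ | tau φ r p.1 p.2 < s}) ∪
        ({p : M × ℝ | GG φ r p.1}ᶜ ∩ {p : M × ℝ | p.2 < s}) := by
      ext p
      by_cases hp : GG φ r p.1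
      · simp [hp, h.lt_sig hrep hp]
      · simp [hp, sig_not hp]
    rw [this]
    have hg : MeasurableSet {p : M × ℝ | GG φ r p.1} := measurable_fst h.GG_meas
    exact (hg.inter (measurableSet_lt h.tau_meas measurable_const)).union
      (hg.compl.inter (measurableSet_lt measurable_snd measurable_const))
  formula F hF m := h.form2 hrep hF (Nat.cast_nonneg m)

end Final

/-- Abramov's formula under time change: if `Φ_r` is the time
reparameterization of the flow `Φ` determined by `dτ = r dt` (so that
`φ_r^{τ(x,t)}(x) = φ^t(x)` with `τ(x,t) = ∫₀ᵗ r(φ^s x) ds`), `μ` is ergodic and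
`r ∈ L¹(μ)` with `∫ r dμ > 0`, then `h_{μ_r}(Φ_r) · ∫ r dμ = h_μ(Φ)`. -/
theorem stmt9 {M : Type*} [MeasurableSpace M] (μ : Measure M) [IsProbabilityMeasure μ]
    (φ φr : ℝ → M → M)
    (hφ0 : φ 0 = id) (hφadd : ∀ s t, φ (s + t) = φ s ∘ φ t)
    (hφr0 : φr 0 = id) (hφradd : ∀ s t, φr (s + t) = φr s ∘ φr t)
    (hφm : Measurable fun p : ℝ × M => φ p.1 p.2)
    (hφrm : Measurable fun p : ℝ × M => φr p.1 p.2)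
    (hmp : ∀ t, MeasurePreserving (φ t) μ μ)
    (herg : ∀ A : Set M, MeasurableSet A → (∀ t, φ t ⁻¹' A = A) → μ A = 0 ∨ μ A = 1)
    (r : M → ℝ) (hrm : Measurable r) (hr0 : ∀ x, 0 ≤ r x)
    (hri : Integrable r μ) (hrpos : 0 < ∫ x, r x ∂μ)
    (hrep : ∀ x t, φr (∫ s in (0:ℝ)..t, r (φ s x)) x = φ t x) :
    metricEntropy (φr 1)
        ((ENNReal.ofReal (∫ x, r x ∂μ))⁻¹ • μ.withDensity fun x => ENNReal.ofReal (r x))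
        * (∫ x, r x ∂μ)
      = metricEntropy (φ 1) μ := by
  have h : FD φ μ r := ⟨hφ0, hφadd, hφm, hmp, herg, hrm, hr0, hri, hrpos⟩
  have hrep' : ∀ x t, φr (tau φ r x t) x = φ t x := hrep
  have hp : IsProbabilityMeasure (mur μ r) := h.mur_prob
  have key := abramov_abs (μ := μ) (ν := mur μ r) (h.tcA hφrm hφr0 hφradd hrep') (h.tcB hφrm hφr0 hφradd hrep')
  exact key
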